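/- arXiv:2501.02466 — 2 statements merged into one kernel-verified Lean document; each statement's English description precedes it below -/
import Mathlib

section
/- Let T be a 1-tilting module over an artin algebra A. Then for every M ∈ fac(T), any right add(T)-approximation f : Tⁿ → M is surjective and its kernel lies in fac(T). Consequently, the exact category fac(T) has enough projectives, and its projective objects are exactly the modules in add(T). -/
/-- The `n`-th Ext-group `Ext_A^n(M, N)` of left `A`-modules. -/
noncomputable def egrp (A : Type) [Ring A] (n : ℕ) (M N : Type) [AddCommGroup M] [Module A M]
    [AddCommGroup N] [Module A N] : Type :=
  ((_root_.Ext ℤ (ModuleCat A) n).obj (Opposite.op (ModuleCat.of A M))).obj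
    (ModuleCat.of A N)

noncomputable instance (A : Type) [Ring A] (n : ℕ) (M N : Type) [AddCommGroup M] [Module A M]
    [AddCommGroup N] [Module A N] : AddCommGroup (egrp A n M N) :=
  inferInstanceAs (AddCommGroup (((_root_.Ext ℤ (ModuleCat A) n).obj
    (Opposite.op (ModuleCat.of A M))).obj (ModuleCat.of A N)))

section Count

variable (B : Type) [Ring B]

/-- `M` is an indecomposable module. -/
def isIndec (M : Type) [AddCommGroup M] [Module B M] : Prop :=
  Nontrivial M ∧ ∀ (X Y : Type) [AddCommGroup X] [Module B X] [AddCommGroup Y] [Module B Y],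
    Nonempty (M ≃ₗ[B] X × Y) → Subsingleton X ∨ Subsingleton Y

/-- The setoid identifying isomorphic modules satisfying a given predicate. -/
def isoSetoid (pred : ModuleCat B → Prop) : Setoid {N : ModuleCat B // pred N} where
  r X Y := Nonempty (↥X.1 ≃ₗ[B] ↥Y.1)
  iseqv := ⟨fun _ => ⟨LinearEquiv.refl B _⟩, fun ⟨e⟩ => ⟨e.symm⟩, fun ⟨e⟩ ⟨f⟩ => ⟨e.trans f⟩⟩

/-- `|M|`: the number of isomorphism classes of indecomposable direct summands of `M`. -/
noncomputable def numIndec (M : Type) [AddCommGroup M] [Module B M] : ℕ :=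
  Nat.card (Quotient (isoSetoid B (fun N => isIndec B ↥N ∧
    ∃ (s : ↥N →ₗ[B] M) (r : M →ₗ[B] ↥N), r.comp s = LinearMap.id)))

end Count

section Fac

variable (A : Type) [Ring A]

/-- `fac(T)`: the class of factor modules of finite direct sums of copies of `T`. -/
def facP (T : Type) [AddCommGroup T] [Module A T]
    (M : Type) [AddCommGroup M] [Module A M] : Prop :=
  ∃ (n : ℕ) (f : (Fin n → T) →ₗ[A] M), Function.Surjective f

/-- `M` is a direct summand of `N`. -/
def isSummand (M N : Type) [AddCommGroup M] [Module A M] [AddCommGroup N] [Module A N] :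
    Prop :=
  ∃ (s : M →ₗ[A] N) (r : N →ₗ[A] M), r.comp s = LinearMap.id

/-- `add(T)`: direct summands of finite direct sums of copies of `T`. -/
def addP (T : Type) [AddCommGroup T] [Module A T]
    (M : Type) [AddCommGroup M] [Module A M] : Prop :=
  ∃ n : ℕ, isSummand A M (Fin n → T)

/-- The module `T` has projective dimension at most one. -/
def pdLeOne (T : Type) [AddCommGroup T] [Module A T] : Prop :=
  ∃ (P₀ P₁ : ModuleCat.{0} A) (_ : Module.Projective A ↥P₀) (_ : Module.Projective A ↥P₁)
    (i : ↥P₁ →ₗ[A] ↥P₀) (p : ↥P₀ →ₗ[A] T),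
      Function.Injective i ∧ Function.Surjective p ∧ Function.Exact i p

/-- `M` is a projective object of the exact category `fac(T)`. -/
def projInFac (T : Type) [AddCommGroup T] [Module A T]
    (M : Type) [AddCommGroup M] [Module A M] : Prop :=
  facP A T M ∧ ∀ (X Y Z : Type) [AddCommGroup X] [Module A X] [AddCommGroup Y] [Module A Y]
    [AddCommGroup Z] [Module A Z] (i : X →ₗ[A] Y) (p : Y →ₗ[A] Z),
      Function.Injective i → Function.Surjective p → Function.Exact i p →
      facP A T X → facP A T Y → facP A T Z →
      ∀ g : M →ₗ[A] Z, ∃ h : M →ₗ[A] Y, p.comp h = g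

end Fac


section Elem
variable {A : Type} [Ring A]

theorem lift_inj {K P T C : Type} [AddCommGroup K] [Module A K] [AddCommGroup P] [Module A P]
    [AddCommGroup T] [Module A T] [AddCommGroup C] [Module A C]
    {i : K →ₗ[A] P} {p : P →ₗ[A] T} (hi : Function.Injective i) (hip : Function.Exact i p)
    (f : C →ₗ[A] P) (hf : p.comp f = 0) : ∃ g : C →ₗ[A] K, i.comp g = f := by
  have h : ∀ c, f c ∈ LinearMap.range i := fun c =>
    (hip (f c)).1 (LinearMap.congr_fun hf c)
  refine ⟨(LinearEquiv.ofInjective i hi).symm.toLinearMap.comp (f.codRestrict _ h), ?_⟩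
  ext c
  have := (LinearEquiv.ofInjective i hi).apply_symm_apply (f.codRestrict _ h c)
  exact congrArg Subtype.val this

theorem desc_surj {K P T C : Type} [AddCommGroup K] [Module A K] [AddCommGroup P] [Module A P]
    [AddCommGroup T] [Module A T] [AddCommGroup C] [Module A C]
    {i : K →ₗ[A] P} {p : P →ₗ[A] T} (hp : Function.Surjective p) (hip : Function.Exact i p)
    (f : P →ₗ[A] C) (hf : f.comp i = 0) : ∃ g : T →ₗ[A] C, g.comp p = f := by
  have h : LinearMap.ker p ≤ LinearMap.ker f := by
    intro x hx
    obtain ⟨y, rfl⟩ := (hip x).1 hx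
    exact LinearMap.congr_fun hf y
  refine ⟨((LinearMap.ker p).liftQ f h).comp (p.quotKerEquivOfSurjective hp).symm.toLinearMap, ?_⟩
  ext x
  have : (p.quotKerEquivOfSurjective hp).symm (p x) = Submodule.Quotient.mk x := by
    rw [LinearEquiv.symm_apply_eq]; rfl
  simp [this]

/-- Comparison of two presentations. -/
theorem compare_pres {C₀ C₁ P₀ P₁ T S : Type}
    [AddCommGroup C₀] [Module A C₀] [AddCommGroup C₁] [Module A C₁]
    [AddCommGroup P₀] [Module A P₀] [AddCommGroup P₁] [Module A P₁]
    [AddCommGroup T] [Module A T] [AddCommGroup S] [Module A S]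
    [Module.Projective A C₀] [Module.Projective A P₀]
    {d : C₁ →ₗ[A] C₀} {q : C₀ →ₗ[A] T} {i : P₁ →ₗ[A] P₀} {p : P₀ →ₗ[A] S}
    (hq : Function.Surjective q) (hdq : Function.Exact d q)
    (hi : Function.Injective i) (hp : Function.Surjective p) (hip : Function.Exact i p)
    (s : S →ₗ[A] T) (r : T →ₗ[A] S) (hrs : r.comp s = LinearMap.id) :
    ∃ (γ₀ : C₀ →ₗ[A] P₀) (γ₁ : C₁ →ₗ[A] P₁) (δ₀ : P₀ →ₗ[A] C₀) (h : P₀ →ₗ[A] P₁),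
      i.comp γ₁ = γ₀.comp d ∧ q.comp δ₀ = s.comp p ∧
      (∀ x c, δ₀ (i x) = d c → γ₁ c = x + h (i x)) := by
  obtain ⟨γ₀, hγ₀⟩ := Module.projective_lifting_property p (r.comp q) hp
  obtain ⟨δ₀, hδ₀⟩ := Module.projective_lifting_property q (s.comp p) hq
  obtain ⟨γ₁, hγ₁⟩ := lift_inj hi hip (γ₀.comp d) (by
    rw [← LinearMap.comp_assoc, hγ₀, LinearMap.comp_assoc, hdq.linearMap_comp_eq_zero,
      LinearMap.comp_zero])
  obtain ⟨h, hh⟩ := lift_inj hi hip (γ₀.comp δ₀ - LinearMap.id) (by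
    rw [LinearMap.comp_sub, ← LinearMap.comp_assoc, hγ₀, LinearMap.comp_assoc, hδ₀,
      ← LinearMap.comp_assoc, hrs]; simp)
  refine ⟨γ₀, γ₁, δ₀, h, hγ₁, hδ₀, fun x c hc => hi ?_⟩
  have e1 := LinearMap.congr_fun hγ₁ c
  have e2 := LinearMap.congr_fun hh (i x)
  simp only [LinearMap.comp_apply, LinearMap.sub_apply, LinearMap.id_apply] at e1 e2
  rw [e1, ← hc, map_add, e2]; abel

/-- `T`-lifting problem along `i : P₁ → P₀` is solvable with values in `Z`. -/
def EVan {P₀ P₁ : Type} [AddCommGroup P₀] [Module A P₀] [AddCommGroup P₁]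
    [Module A P₁] (i : P₁ →ₗ[A] P₀) (Z : Type) [AddCommGroup Z] [Module A Z] : Prop :=
  ∀ φ : P₁ →ₗ[A] Z, ∃ ψ : P₀ →ₗ[A] Z, ψ.comp i = φ

/-- Transfer of extension properties. -/
theorem extend_of_compare {C₀ C₁ P₀ P₁ T S Z : Type}
    [AddCommGroup C₀] [Module A C₀] [AddCommGroup C₁] [Module A C₁]
    [AddCommGroup P₀] [Module A P₀] [AddCommGroup P₁] [Module A P₁]
    [AddCommGroup T] [Module A T] [AddCommGroup S] [Module A S] [AddCommGroup Z] [Module A Z]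
    [Module.Projective A C₀] [Module.Projective A P₀]
    {d : C₁ →ₗ[A] C₀} {q : C₀ →ₗ[A] T} {i : P₁ →ₗ[A] P₀} {p : P₀ →ₗ[A] S}
    (hq : Function.Surjective q) (hdq : Function.Exact d q)
    (hi : Function.Injective i) (hp : Function.Surjective p) (hip : Function.Exact i p)
    (s : S →ₗ[A] T) (r : T →ₗ[A] S) (hrs : r.comp s = LinearMap.id)
    (hC : ∀ φ : C₁ →ₗ[A] Z, (∀ c, d c = 0 → φ c = 0) → ∃ ψ : C₀ →ₗ[A] Z, ψ.comp d = φ) :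
    EVan i Z := by
  intro φ
  obtain ⟨γ₀, γ₁, δ₀, h, h1, h2, h3⟩ := compare_pres hq hdq hi hp hip s r hrs
  obtain ⟨ψ, hψ⟩ := hC (φ.comp γ₁) (by
    intro c hc
    have : γ₁ c = 0 := hi (by
      have := LinearMap.congr_fun h1 c
      simpa [hc] using this)
    simp [this])
  refine ⟨ψ.comp δ₀ - φ.comp h, ?_⟩
  ext x
  obtain ⟨c, hc⟩ := (hdq (δ₀ (i x))).1 (by
    have := LinearMap.congr_fun h2 (i x)
    simp only [LinearMap.comp_apply] at this
    rw [this, hip.apply_apply_eq_zero, map_zero])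
  have e := LinearMap.congr_fun hψ c
  have e3 := h3 x c hc.symm
  simp only [LinearMap.comp_apply] at e
  simp only [LinearMap.comp_apply, LinearMap.sub_apply]
  rw [← hc, e, e3, map_add]; abel

/-- Kernels of projective covers of summands of modules of projective dimension `≤ 1`. -/
theorem proj_of_compare {C₀ C₁ P₀ P₁ T S : Type}
    [AddCommGroup C₀] [Module A C₀] [AddCommGroup C₁] [Module A C₁]
    [AddCommGroup P₀] [Module A P₀] [AddCommGroup P₁] [Module A P₁]
    [AddCommGroup T] [Module A T] [AddCommGroup S] [Module A S]
    [Module.Projective A C₀] [Module.Projective A P₀] [Module.Projective A C₁]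
    {d : C₁ →ₗ[A] C₀} {q : C₀ →ₗ[A] T} {i : P₁ →ₗ[A] P₀} {p : P₀ →ₗ[A] S}
    (hd : Function.Injective d)
    (hq : Function.Surjective q) (hdq : Function.Exact d q)
    (hi : Function.Injective i) (hp : Function.Surjective p) (hip : Function.Exact i p)
    (s : S →ₗ[A] T) (r : T →ₗ[A] S) (hrs : r.comp s = LinearMap.id) :
    Module.Projective A P₁ := by
  obtain ⟨γ₀, γ₁, δ₀, h, h1, h2, h3⟩ := compare_pres hq hdq hi hp hip s r hrs
  obtain ⟨δ₁, hδ₁⟩ := lift_inj hd hdq (δ₀.comp i) (by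
    rw [← LinearMap.comp_assoc, h2, LinearMap.comp_assoc, hip.linearMap_comp_eq_zero,
      LinearMap.comp_zero])
  refine Module.Projective.of_split (M := C₁ × P₀) (δ₁.prod i) (γ₁.coprod (-h)) ?_
  ext x
  have := h3 x (δ₁ x) (LinearMap.congr_fun hδ₁ x).symm
  simp [this]

theorem EVan_pi {P₀ P₁ : Type} [AddCommGroup P₀] [Module A P₀] [AddCommGroup P₁]
    [Module A P₁] {i : P₁ →ₗ[A] P₀} {Z : Type} [AddCommGroup Z] [Module A Z] (h : EVan i Z)
    (ι : Type) : EVan i (ι → Z) := by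
  intro φ
  choose ψ hψ using fun k => h ((LinearMap.proj k).comp φ)
  refine ⟨LinearMap.pi ψ, ?_⟩
  ext x k
  exact LinearMap.congr_fun (hψ k) x

theorem EVan_surj {P₀ P₁ : Type} [AddCommGroup P₀] [Module A P₀] [AddCommGroup P₁]
    [Module A P₁] [Module.Projective A P₁] {i : P₁ →ₗ[A] P₀} {Y Z : Type} [AddCommGroup Z]
    [Module A Z] [AddCommGroup Y] [Module A Y] (h : EVan i Y)
    (f : Y →ₗ[A] Z) (hf : Function.Surjective f) : EVan i Z := by
  intro φ
  obtain ⟨φ', hφ'⟩ := Module.projective_lifting_property f φ hf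
  obtain ⟨ψ, hψ⟩ := h φ'
  exact ⟨f.comp ψ, by rw [LinearMap.comp_assoc, hψ, hφ']⟩

theorem EVan_ker {P₀ P₁ T : Type} [AddCommGroup P₀] [Module A P₀] [AddCommGroup P₁]
    [Module A P₁] [AddCommGroup T] [Module A T] {i : P₁ →ₗ[A] P₀} {p : P₀ →ₗ[A] T}
    (hp : Function.Surjective p) (hip : Function.Exact i p)
    {X Y Z : Type} [AddCommGroup X] [Module A X] [AddCommGroup Z]
    [Module A Z] [AddCommGroup Y] [Module A Y] (h : EVan i Y)
    {j : X →ₗ[A] Y} {f : Y →ₗ[A] Z} (hj : Function.Injective j) (hjf : Function.Exact j f)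
    (hl : ∀ g : T →ₗ[A] Z, ∃ h : T →ₗ[A] Y, f.comp h = g) : EVan i X := by
  intro φ
  obtain ⟨ψ, hψ⟩ := h (j.comp φ)
  obtain ⟨g, hg⟩ := desc_surj hp hip (f.comp ψ) (by
    rw [LinearMap.comp_assoc, hψ, ← LinearMap.comp_assoc, hjf.linearMap_comp_eq_zero,
      LinearMap.zero_comp])
  obtain ⟨u, hu⟩ := hl g
  obtain ⟨χ, hχ⟩ := lift_inj hj hjf (ψ - u.comp p) (by
    rw [LinearMap.comp_sub, ← LinearMap.comp_assoc, hu, hg, sub_self])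
  refine ⟨χ, ?_⟩
  ext x
  apply hj
  have e1 := LinearMap.congr_fun hχ (i x)
  have e2 := LinearMap.congr_fun hψ x
  simp only [LinearMap.comp_apply, LinearMap.sub_apply] at e1 e2 ⊢
  rw [e1, e2, hip.apply_apply_eq_zero, map_zero, sub_zero]

theorem lift_of_EVan {P₀ P₁ T : Type} [AddCommGroup P₀] [Module A P₀] [AddCommGroup P₁]
    [Module A P₁] [AddCommGroup T] [Module A T] [Module.Projective A P₀]
    {i : P₁ →ₗ[A] P₀} {p : P₀ →ₗ[A] T}
    (hp : Function.Surjective p) (hip : Function.Exact i p)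
    {X Y Z : Type} [AddCommGroup X] [Module A X] [AddCommGroup Z]
    [Module A Z] [AddCommGroup Y] [Module A Y] (h : EVan i X)
    {j : X →ₗ[A] Y} {f : Y →ₗ[A] Z} (hj : Function.Injective j) (hjf : Function.Exact j f)
    (hf : Function.Surjective f) (g : T →ₗ[A] Z) : ∃ h : T →ₗ[A] Y, f.comp h = g := by
  obtain ⟨ψ, hψ⟩ := Module.projective_lifting_property f (g.comp p) hf
  obtain ⟨φ, hφ⟩ := lift_inj hj hjf (ψ.comp i) (by
    rw [← LinearMap.comp_assoc, hψ, LinearMap.comp_assoc, hip.linearMap_comp_eq_zero,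
      LinearMap.comp_zero])
  obtain ⟨χ, hχ⟩ := h φ
  obtain ⟨u, hu⟩ := desc_surj hp hip (ψ - j.comp χ) (by
    rw [LinearMap.sub_comp, LinearMap.comp_assoc, hχ, hφ, sub_self])
  refine ⟨u, ?_⟩
  ext t
  obtain ⟨x, rfl⟩ := hp t
  have e1 := LinearMap.congr_fun hu x
  have e2 := LinearMap.congr_fun hψ x
  simp only [LinearMap.comp_apply, LinearMap.sub_apply] at e1 e2 ⊢
  rw [e1, map_sub, e2, hjf.apply_apply_eq_zero, sub_zero]

end Elem
open CategoryTheory in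
/-- Vanishing of derived `Ext¹` in terms of a projective resolution. -/
theorem bridge_res (A : Type) [Ring A] (T : Type) [AddCommGroup T] [Module A T]
    (h : Subsingleton (egrp A 1 T T)) (P : ProjectiveResolution (ModuleCat.of A T))
    (x : P.complex.X 1 ⟶ ModuleCat.of A T) (hx : P.complex.d 2 1 ≫ x = 0) :
    ∃ y : P.complex.X 0 ⟶ ModuleCat.of A T, P.complex.d 1 0 ≫ y = x := by
  have hz : Limits.IsZero ((P.complex.linearYonedaObj ℤ (ModuleCat.of A T)).homology 1) := by
    refine Limits.IsZero.of_iso ?_ (P.isoExt 1 (ModuleCat.of A T)).symm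
    exact @ModuleCat.isZero_of_subsingleton _ _ _ h
  rw [← HomologicalComplex.exactAt_iff_isZero_homology,
    HomologicalComplex.exactAt_iff' _ 0 1 2 (by simp) (by simp)] at hz
  rw [ShortComplex.moduleCat_exact_iff] at hz
  obtain ⟨y, hy⟩ := hz x hx
  exact ⟨y, hy⟩

open CategoryTheory in
theorem bridge (A : Type) [Ring A] (T : Type) [AddCommGroup T] [Module A T]
    (h : Subsingleton (egrp A 1 T T))
    {P₀ P₁ : Type} [AddCommGroup P₀] [Module A P₀] [AddCommGroup P₁]
    [Module A P₁] [Module.Projective A P₀] [Module.Projective A P₁]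
    (i : P₁ →ₗ[A] P₀) (p : P₀ →ₗ[A] T) (hi : Function.Injective i)
    (hp : Function.Surjective p) (hip : Function.Exact i p) : EVan i T := by
  obtain ⟨P⟩ : Nonempty (ProjectiveResolution (ModuleCat.of A T)) :=
    (HasProjectiveResolution.out (Z := ModuleCat.of A T))
  have hproj : ∀ n, Module.Projective A (P.complex.X n) := fun n =>
    (IsProjective.iff_projective _).2 (P.projective n)
  let q : P.complex.X 0 →ₗ[A] T := (P.π.f 0).hom
  let d₁ : P.complex.X 1 →ₗ[A] P.complex.X 0 := (P.complex.d 1 0).hom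
  let d₂ : P.complex.X 2 →ₗ[A] P.complex.X 1 := (P.complex.d 2 1).hom
  have hq : Function.Surjective q := by
    have : Epi (P.π.f 0) := inferInstance
    exact (ModuleCat.epi_iff_surjective _).1 this
  have hqd : Function.Exact d₁ q := by
    have := P.exact₀
    exact (ShortComplex.ShortExact.moduleCat_exact_iff_function_exact _).1 this
  have hdd : ∀ x, d₁ (d₂ x) = 0 := fun x => by
    have := P.complex.d_comp_d 2 1 0
    exact congrArg (fun f => f.hom x) this
  refine extend_of_compare (C₀ := P.complex.X 0) (C₁ := P.complex.X 1) (d := d₁) (q := q)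
    hq hqd hi hp hip LinearMap.id LinearMap.id rfl ?_
  intro φ hφ
  obtain ⟨y, hy⟩ := bridge_res A T h P (ModuleCat.ofHom φ) (by
    ext x
    exact hφ _ (hdd x))
  refine ⟨y.hom, ?_⟩
  ext x
  exact congrArg (fun f => f.hom x) hy

section Indec
variable {A : Type} [Ring A]

/-- Splitting equivalence. -/
theorem split_equiv {M N : Type} [AddCommGroup M] [Module A M] [AddCommGroup N] [Module A N]
    (s : N →ₗ[A] M) (r : M →ₗ[A] N) (h : r.comp s = LinearMap.id) :
    Nonempty (M ≃ₗ[A] N × LinearMap.ker r) := by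
  have h' : ∀ x, r (s x) = x := fun x => LinearMap.congr_fun h x
  refine ⟨LinearEquiv.ofLinearMap
    (r.prod ((LinearMap.id - s.comp r).codRestrict (LinearMap.ker r) (by intro x; simp [h'])))
    (s.coprod (LinearMap.ker r).subtype) ?_ ?_⟩
  · ext x
    · simp [h']
    · simp [h']
    · simp
    · simp [LinearMap.mem_ker.1 x.2]
  · ext x
    simp

theorem indec_retract_iso {M N : Type} [AddCommGroup M] [Module A M] [AddCommGroup N] [Module A N]
    (hM : isIndec A M) [Nontrivial N]
    (s : N →ₗ[A] M) (r : M →ₗ[A] N) (h : Function.Bijective (r.comp s)) :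
    Nonempty (M ≃ₗ[A] N) := by
  let e := LinearEquiv.ofBijective _ h
  let r' : M →ₗ[A] N := e.symm.toLinearMap.comp r
  have h' : r'.comp s = LinearMap.id := by
    ext x
    exact e.symm_apply_apply x
  obtain ⟨E⟩ := split_equiv s r' h'
  rcases hM.2 _ _ ⟨E⟩ with h1 | h1
  · exact absurd h1 (not_subsingleton N)
  · refine ⟨LinearEquiv.ofBijective r' ⟨?_, fun x => ⟨s x, LinearMap.congr_fun h' x⟩⟩⟩
    rw [← LinearMap.ker_eq_bot]
    exact (Submodule.subsingleton_iff_eq_bot).1 h1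

theorem indec_end {M : Type} [AddCommGroup M] [Module A M] [IsArtinian A M] [IsNoetherian A M]
    (hM : isIndec A M) (φ : Module.End A M) : IsUnit φ ∨ IsNilpotent φ := by
  obtain ⟨n, hn⟩ := Filter.eventually_atTop.1 (φ.eventually_isCompl_ker_pow_range_pow)
  have hc := hn (n + 1) (by omega)
  rcases hM.2 _ _ ⟨(Submodule.prodEquivOfIsCompl _ _ hc).symm⟩ with h | h
  · left
    have h1 := (Submodule.subsingleton_iff_eq_bot).1 h
    have h2 : LinearMap.range (φ ^ (n+1)) = ⊤ := by
      have := hc.sup_eq_top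
      rwa [h1, bot_sup_eq] at this
    have : IsUnit (φ ^ (n+1)) := (Module.End.isUnit_iff _).2
      ⟨LinearMap.ker_eq_bot.1 h1, LinearMap.range_eq_top.1 h2⟩
    exact (isUnit_pow_iff (by omega)).1 this
  · right
    exact ⟨n+1, LinearMap.range_eq_bot.1 ((Submodule.subsingleton_iff_eq_bot).1 h)⟩

theorem unit_add {S : Type} [Ring S] (hS : ∀ x : S, IsUnit x ∨ IsNilpotent x) (a b : S)
    (h : IsUnit (a + b)) : IsUnit a ∨ IsUnit b := by
  obtain ⟨u, hu⟩ := h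
  rcases hS (u⁻¹ * a : S) with h1 | h1
  · left; simpa using h1
  · right
    have h2 := h1.isUnit_one_sub
    have : (1 : S) - (u⁻¹ : Sˣ) * a = (u⁻¹ : Sˣ) * b := by
      have : ((u⁻¹ : Sˣ) : S) * (a + b) = 1 := by rw [← hu]; simp
      rw [← this]; noncomm_ring
    rw [this] at h2
    simpa using h2

theorem unit_sum {S : Type} [Ring S] [Nontrivial S] (hS : ∀ x : S, IsUnit x ∨ IsNilpotent x)
    {ι : Type} (t : Finset ι)
    (f : ι → S) (h : IsUnit (∑ k ∈ t, f k)) : ∃ k ∈ t, IsUnit (f k) := by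
  classical
  induction t using Finset.induction_on with
  | empty => simp at h
  | insert k t hk ih =>
    rw [Finset.sum_insert hk] at h
    rcases unit_add hS _ _ h with h | h
    · exact ⟨k, by simp, h⟩
    · obtain ⟨l, hl, h⟩ := ih h
      exact ⟨l, by simp [hl], h⟩

theorem summand_trans {L M N : Type} [AddCommGroup L] [Module A L] [AddCommGroup M] [Module A M]
    [AddCommGroup N] [Module A N] (h1 : isSummand A L M) (h2 : isSummand A M N) :
    isSummand A L N := by
  obtain ⟨s, r, h⟩ := h1
  obtain ⟨s', r', h'⟩ := h2
  refine ⟨s'.comp s, r.comp r', ?_⟩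
  rw [LinearMap.comp_assoc, ← LinearMap.comp_assoc s, h', LinearMap.id_comp, h]

theorem summand_of_bij {M N : Type} [AddCommGroup M] [Module A M]
    [AddCommGroup N] [Module A N] (s : M →ₗ[A] N) (r : N →ₗ[A] M)
    (h : Function.Bijective (r.comp s)) : isSummand A M N := by
  let e := LinearEquiv.ofBijective _ h
  refine ⟨s, e.symm.toLinearMap.comp r, ?_⟩
  ext x
  exact e.symm_apply_apply x

theorem summand_range {M N : Type} [AddCommGroup M] [Module A M]
    [AddCommGroup N] [Module A N] (s : M →ₗ[A] N) (r : N →ₗ[A] M)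
    (h : r.comp s = LinearMap.id) : isSummand A (LinearMap.range s) N := by
  refine ⟨(LinearMap.range s).subtype, s.rangeRestrict.comp r, ?_⟩
  ext ⟨x, y, rfl⟩
  have := LinearMap.congr_fun h y
  simp only [LinearMap.comp_apply, LinearMap.id_apply] at this
  simp [this]

theorem exists_indec (M : Type) [AddCommGroup M] [Module A M] [IsArtinian A M] [Nontrivial M] :
    ∃ N : Submodule A M, isIndec A N ∧ isSummand A N M := by
  let S : Set (Submodule A M) :=
    {N | N ≠ ⊥ ∧ ∃ r : M →ₗ[A] N, r.comp N.subtype = LinearMap.id}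
  have hS : S.Nonempty := ⟨⊤, by simp,
    LinearMap.id.codRestrict _ (by simp), by ext x; simp⟩
  obtain ⟨N, ⟨hN0, r, hr⟩, hmin⟩ :=
    WellFounded.has_min (wellFounded_lt (α := Submodule A M)) S hS
  refine ⟨N, ⟨?_, ?_⟩, _, r, hr⟩
  · exact Submodule.nontrivial_iff_ne_bot.2 hN0
  · intro X Y _ _ _ _ ⟨e⟩
    by_contra! hcon
    obtain ⟨hX, hY⟩ := hcon
    let s : X →ₗ[A] M := (N.subtype.comp e.symm.toLinearMap).comp (LinearMap.inl A X Y)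
    let t : M →ₗ[A] X := (LinearMap.fst A X Y).comp (e.toLinearMap.comp r)
    have hrN : ∀ x : N, r x = x := fun x => LinearMap.congr_fun hr x
    have hts : ∀ x, t (s x) = x := fun x => by simp [s, t, hrN]
    refine hmin (LinearMap.range s) ⟨?_, s.rangeRestrict.comp t, ?_⟩ (lt_of_le_of_ne ?_ ?_)
    · intro h0
      obtain ⟨x, hx⟩ := exists_ne (0 : X)
      have : s x = 0 := LinearMap.congr_fun (LinearMap.range_eq_bot.1 h0) x
      exact hx (by rw [← hts x, this, map_zero])
    · ext ⟨x, y, rfl⟩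
      simp [hts]
    · rintro _ ⟨x, rfl⟩
      exact (e.symm (x, 0)).2
    · intro h0
      obtain ⟨y, hy⟩ := exists_ne (0 : Y)
      have : ((e.symm (0, y) : N) : M) ∈ LinearMap.range s := by
        rw [h0]; exact (e.symm (0, y)).2
      obtain ⟨x, hx⟩ := this
      have h1 : e.symm (x, 0) = e.symm (0, y) := Subtype.ext hx
      have h2 := e.symm.injective h1
      exact hy (congrArg Prod.snd h2).symm

/-- Finitely many isomorphism classes of indecomposable summands. -/
theorem finite_indec [IsArtinianRing A] (n : ℕ∞) :
    ∀ (M : Type) [AddCommGroup M] [Module A M] [Module.Finite A M], Module.length A M = n →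
    ∃ S : Set (ModuleCat.{0} A), S.Finite ∧ ∀ (X : Type) [AddCommGroup X] [Module A X],
      isIndec A X → isSummand A X M → ∃ Y ∈ S, Nonempty (X ≃ₗ[A] Y) := by
  induction n using WellFoundedLT.induction with
  | ind n ih =>
  intro M _ _ _ hn
  rcases subsingleton_or_nontrivial M with hM | hM
  · refine ⟨∅, Set.finite_empty, ?_⟩
    rintro X _ _ hX ⟨s, r, h⟩
    have := hX.1
    obtain ⟨x, hx⟩ := exists_ne (0 : X)
    refine absurd ?_ hx
    have h1 : r (s x) = x := LinearMap.congr_fun h x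
    rw [← h1, Subsingleton.elim (s x) 0, map_zero]
  · obtain ⟨N, hN, s, r, h⟩ := exists_indec (A := A) M
    have hNn := hN.1
    have hr : ∀ x, r (s x) = x := fun x => LinearMap.congr_fun h x
    have hlt : Module.length A (LinearMap.ker r) < n := by
      rw [← hn]
      refine Submodule.length_lt ?_
      intro h0
      obtain ⟨x, hx⟩ := exists_ne (0 : N)
      have : s x ∈ LinearMap.ker r := by rw [h0]; trivial
      rw [LinearMap.mem_ker, hr] at this
      exact hx this
    obtain ⟨S, hS, hS'⟩ := ih _ hlt (LinearMap.ker r) rfl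
    refine ⟨insert (ModuleCat.of A N) S, hS.insert _, ?_⟩
    rintro X _ _ hX ⟨a, b, hab⟩
    have := hX.1
    have hXf : Module.Finite A X := Module.Finite.of_surjective b
      (fun x => ⟨a x, LinearMap.congr_fun hab x⟩)
    let c : M →ₗ[A] LinearMap.ker r := (LinearMap.id - s.comp r).codRestrict _ (by
      intro x; simp [hr])
    have hsum : (show Module.End A X from (b.comp s).comp (r.comp a)) +
        (show Module.End A X from (b.comp (LinearMap.ker r).subtype).comp (c.comp a)) = 1 := by
      rw [← show b.comp a = (1 : Module.End A X) from hab]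
      ext x
      simp [c]
    rcases unit_add (indec_end hX) _ _ (hsum ▸ isUnit_one) with h1 | h1
    · obtain ⟨e⟩ := indec_retract_iso hN _ _ ((Module.End.isUnit_iff _).1 h1)
      exact ⟨_, Set.mem_insert _ _, ⟨e.symm⟩⟩
    · obtain ⟨Y, hY, e⟩ := hS' X hX (summand_of_bij _ _ ((Module.End.isUnit_iff _).1 h1))
      exact ⟨Y, Set.mem_insert_of_mem _ hY, e⟩

theorem finite_classes [IsArtinianRing A] (M : Type) [AddCommGroup M] [Module A M]
    [Module.Finite A M] :
    Finite (Quotient (isoSetoid A (fun N => isIndec A ↥N ∧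
      ∃ (s : ↥N →ₗ[A] M) (r : M →ₗ[A] ↥N), r.comp s = LinearMap.id))) := by
  obtain ⟨S, hS, h⟩ := finite_indec (A := A) _ M rfl
  have := hS.to_subtype
  choose Y hY e using fun (q : Quotient (isoSetoid A (fun N => isIndec A ↥N ∧
      ∃ (s : ↥N →ₗ[A] M) (r : M →ₗ[A] ↥N), r.comp s = LinearMap.id))) =>
      h q.out.1 q.out.2.1 q.out.2.2
  refine Finite.of_injective (fun q => (⟨Y q, hY q⟩ : S)) ?_
  intro q q' hq
  have hq' : Y q = Y q' := congrArg Subtype.val hq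
  have e1 := e q
  rw [hq'] at e1
  obtain ⟨e1⟩ := e1
  obtain ⟨e2⟩ := e q'
  rw [← q.out_eq, ← q'.out_eq]
  exact Quotient.sound ⟨e1.trans e2.symm⟩

/-- An indecomposable projective module of finite length is a summand of the ring. -/
theorem indec_proj_summand [IsArtinianRing A] (Q : Type) [AddCommGroup Q] [Module A Q]
    [Module.Finite A Q] [Module.Projective A Q] (hQ : isIndec A Q) : isSummand A Q A := by
  have := hQ.1
  obtain ⟨n, f, hf⟩ := Module.Finite.exists_fin' A Q
  obtain ⟨g, hg⟩ := Module.projective_lifting_property f LinearMap.id hf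
  let F : Fin n → Module.End A Q := fun k =>
    (f.comp (LinearMap.single A (fun _ => A) k)).comp ((LinearMap.proj k).comp g)
  have hF : ∑ k, F k = 1 := by
    rw [← show f.comp g = (1 : Module.End A Q) from hg]
    ext x
    simp only [F, LinearMap.sum_apply, LinearMap.comp_apply]
    rw [← map_sum]
    congr 1
    exact LinearMap.sum_single_apply (fun _ => A) (g x)
  obtain ⟨k, -, hk⟩ := unit_sum (indec_end hQ) Finset.univ F (hF ▸ isUnit_one)
  exact summand_of_bij _ _ ((Module.End.isUnit_iff _).1 hk)

end Indec

section Len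
variable (R A : Type) [CommRing R] [Ring A] [Algebra R A]

theorem hom_finite [IsNoetherianRing R] [Module.Finite R A]
    (X Z : Type) [AddCommGroup X] [Module A X] [AddCommGroup Z]
    [Module A Z] [Module R Z] [IsScalarTower R A Z] [Module.Finite A X] [Module.Finite A Z] :
    Module.Finite R (X →ₗ[A] Z) := by
  have : Module.Finite R Z := Module.Finite.trans A Z
  obtain ⟨n, f, hf⟩ := Module.Finite.exists_fin' A X
  let Φ : (X →ₗ[A] Z) →ₗ[R] (Fin n → Z) :=
    { toFun := fun g k => g (f (Pi.single k 1))
      map_add' := fun _ _ => rfl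
      map_smul' := fun _ _ => rfl }
  refine Module.Finite.of_injective Φ ?_
  intro g g' h
  have : g.comp f = g'.comp f := by
    refine LinearMap.pi_ext' fun k => LinearMap.ext_ring ?_
    exact congrFun h k
  ext x
  obtain ⟨y, rfl⟩ := hf x
  exact LinearMap.congr_fun this y

theorem tower_compHom (Z : Type) [AddCommGroup Z] [Module A Z] :
    letI := Module.compHom Z (algebraMap R A)
    IsScalarTower R A Z := by
  let _ := Module.compHom Z (algebraMap R A)
  refine ⟨fun r a z => ?_⟩
  rw [Algebra.smul_def, mul_smul]
  rfl

/-- The length over `R` of the module of homomorphisms. -/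
noncomputable def hl (X Z : Type) [AddCommGroup X] [Module A X] [AddCommGroup Z]
    [Module A Z] : ℕ :=
  letI := Module.compHom Z (algebraMap R A)
  haveI := tower_compHom R A Z
  (Module.length R (X →ₗ[A] Z)).toNat

variable [IsArtinianRing R] [Module.Finite R A]

theorem hl_exact (K P X Z : Type) [AddCommGroup K] [Module A K] [AddCommGroup P] [Module A P]
    [AddCommGroup X] [Module A X] [AddCommGroup Z] [Module A Z]
    [Module.Finite A K] [Module.Finite A P] [Module.Finite A X] [Module.Finite A Z]
    {i : K →ₗ[A] P} {p : P →ₗ[A] X} (hp : Function.Surjective p) (hip : Function.Exact i p)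
    (h : EVan i Z) : hl R A P Z = hl R A X Z + hl R A K Z := by
  let _ := Module.compHom Z (algebraMap R A)
  have := tower_compHom R A Z
  have := hom_finite R A K Z
  have := hom_finite R A P Z
  have := hom_finite R A X Z
  let f : (X →ₗ[A] Z) →ₗ[R] (P →ₗ[A] Z) :=
    { toFun := fun g => g.comp p
      map_add' := fun _ _ => rfl
      map_smul' := fun _ _ => rfl }
  let g : (P →ₗ[A] Z) →ₗ[R] (K →ₗ[A] Z) :=
    { toFun := fun g => g.comp i
      map_add' := fun _ _ => rfl
      map_smul' := fun _ _ => rfl }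
  have := Module.length_eq_add_of_exact f g (fun a b hab => (LinearMap.cancel_right hp).1 hab)
    (fun φ => h φ) (fun φ => ⟨fun hφ => desc_surj hp hip φ hφ, by
      rintro ⟨u, rfl⟩
      change (u.comp p).comp i = 0
      rw [LinearMap.comp_assoc, hip.linearMap_comp_eq_zero, LinearMap.comp_zero]⟩)
  unfold hl
  rw [this, ENat.toNat_add Module.length_ne_top Module.length_ne_top]

theorem hl_le (X I Z : Type) [AddCommGroup X] [Module A X] [AddCommGroup I] [Module A I]
    [AddCommGroup Z] [Module A Z]
    [Module.Finite A X] [Module.Finite A I] [Module.Finite A Z]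
    (j : I →ₗ[A] Z) (hj : Function.Injective j) : hl R A X I ≤ hl R A X Z ∧
      (hl R A X I = hl R A X Z ↔ ∀ g : X →ₗ[A] Z, ∃ g' : X →ₗ[A] I, j.comp g' = g) := by
  let _ := Module.compHom Z (algebraMap R A)
  have := tower_compHom R A Z
  let _ := Module.compHom I (algebraMap R A)
  have := tower_compHom R A I
  have := hom_finite R A X I
  have := hom_finite R A X Z
  let f : (X →ₗ[A] I) →ₗ[R] (X →ₗ[A] Z) :=
    { toFun := fun g => j.comp g
      map_add' := fun _ _ => by ext; simp
      map_smul' := fun r g => by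
        ext x
        exact j.map_smul (algebraMap R A r) (g x) }
  have hf : Function.Injective f := fun a b hab => (LinearMap.cancel_left hj).1 hab
  have e : Module.length R (LinearMap.range f) = Module.length R (X →ₗ[A] I) :=
    (LinearEquiv.ofInjective f hf).length_eq.symm
  have hle := Module.length_le_of_injective f hf
  have e0 : (hl R A X I = hl R A X Z ↔
      Module.length R (X →ₗ[A] I) = Module.length R (X →ₗ[A] Z)) :=
    ⟨fun h => by
      rw [← ENat.natCast_toNat (Module.length_ne_top (R := R) (M := X →ₗ[A] I)),
        ← ENat.natCast_toNat (Module.length_ne_top (R := R) (M := X →ₗ[A] Z))]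
      exact congrArg _ h, fun h => congrArg ENat.toNat h⟩
  refine ⟨ENat.toNat_le_toNat hle Module.length_ne_top, e0.trans ⟨fun h => ?_, fun h => ?_⟩⟩
  · by_contra hcon
    have : LinearMap.range f ≠ ⊤ := fun ht => hcon (fun g => (LinearMap.range_eq_top.1 ht) g)
    have := Submodule.length_lt this
    rw [e, h] at this
    exact lt_irrefl _ this
  · exact (LinearEquiv.ofBijective f ⟨hf, h⟩).length_eq

theorem hl_eq_zero (X Z : Type) [AddCommGroup X] [Module A X]
    [AddCommGroup Z] [Module A Z] [Module.Finite A X] [Module.Finite A Z] :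
    hl R A X Z = 0 ↔ Subsingleton (X →ₗ[A] Z) := by
  let _ := Module.compHom Z (algebraMap R A)
  have := tower_compHom R A Z
  have := hom_finite R A X Z
  unfold hl
  rw [ENat.toNat_eq_zero, or_iff_left Module.length_ne_top, Module.length_eq_zero_iff]

theorem hl_congr (X Y Z : Type) [AddCommGroup X] [Module A X] [AddCommGroup Y] [Module A Y]
    [AddCommGroup Z] [Module A Z]
    [Module.Finite A X] [Module.Finite A Y] [Module.Finite A Z]
    (e : X ≃ₗ[A] Y) : hl R A X Z = hl R A Y Z := by
  have := hl_exact R A PUnit.{1} X Y Z (i := 0) (p := e.toLinearMap) e.surjective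
    (by
      intro x
      simp [eq_comm (a := (0 : X))])
    (fun φ => ⟨0, by ext x; rw [Subsingleton.elim x 0, map_zero, map_zero]⟩)
  rw [this, (hl_eq_zero R A PUnit Z).2
    ⟨fun a b => by ext x; rw [Subsingleton.elim x 0, map_zero, map_zero]⟩,
    add_zero]

/-- The function `hl P` is a combination of the functions `hl (Q j)`. -/
theorem hl_decomp [IsArtinianRing A] {m : ℕ} (Q : Fin m → ModuleCat.{0} A)
    (hQf : ∀ j, Module.Finite A (Q j))
    (hQ : ∀ (X : Type) [AddCommGroup X] [Module A X], isIndec A X → isSummand A X A →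
      ∃ j, Nonempty (X ≃ₗ[A] Q j)) (n : ℕ∞) :
    ∀ (P : Type) [AddCommGroup P] [Module A P] [Module.Finite A P] [Module.Projective A P],
    Module.length A P = n →
    ∃ a : Fin m → ℕ, ∀ (Z : Type) [AddCommGroup Z] [Module A Z] [Module.Finite A Z],
      hl R A P Z = ∑ j, a j * hl R A (Q j) Z := by
  induction n using WellFoundedLT.induction with
  | ind n ih =>
  intro P _ _ _ _ hn
  rcases subsingleton_or_nontrivial P with hM | hM
  · refine ⟨0, ?_⟩
    intro Z _ _ _
    rw [(hl_eq_zero R A P Z).2 ⟨fun a b => by ext x; rw [Subsingleton.elim x 0, map_zero, map_zero]⟩]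
    simp
  · obtain ⟨N, hN, s, r, h⟩ := exists_indec (A := A) P
    have hNn := hN.1
    have hr : ∀ x, r (s x) = x := fun x => LinearMap.congr_fun h x
    have hlt : Module.length A (LinearMap.ker r) < n := by
      rw [← hn]
      refine Submodule.length_lt ?_
      intro h0
      obtain ⟨x, hx⟩ := exists_ne (0 : N)
      have : s x ∈ LinearMap.ker r := by rw [h0]; trivial
      rw [LinearMap.mem_ker, hr] at this
      exact hx this
    let c : P →ₗ[A] LinearMap.ker r := (LinearMap.id - s.comp r).codRestrict _ (by
      intro x; simp [hr])
    have hc : c.comp (LinearMap.ker r).subtype = LinearMap.id := by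
      ext x
      simp [c]
    have : Module.Projective A (LinearMap.ker r) := Module.Projective.of_split _ c hc
    have : Module.Projective A N := Module.Projective.of_split s r h
    obtain ⟨a, ha⟩ := ih _ hlt (LinearMap.ker r) rfl
    obtain ⟨j, ⟨e⟩⟩ := hQ N hN (indec_proj_summand N hN)
    refine ⟨a + Pi.single j 1, ?_⟩
    intro Z _ _ _
    rw [hl_exact R A (LinearMap.ker r) P N Z (i := (LinearMap.ker r).subtype) (p := r)
      (fun x => ⟨s x, hr x⟩) (LinearMap.exact_subtype_ker_map r)
      (fun φ => ⟨φ.comp c, by rw [LinearMap.comp_assoc, hc, LinearMap.comp_id]⟩), ha Z,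
      hl_congr R A N (Q j) Z e]
    simp [add_mul, Finset.sum_add_distrib, Pi.single_apply, add_comm]

end Len

/-- Approximations exist. -/
theorem exists_approx (R A : Type) [CommRing R] [Ring A] [Algebra R A] [IsArtinianRing R]
    [Module.Finite R A] (W Z : Type) [AddCommGroup W] [Module A W]
    [AddCommGroup Z] [Module A Z] [Module.Finite A W] [Module.Finite A Z] :
    ∃ (n : ℕ) (f : (Fin n → W) →ₗ[A] Z),
      ∀ g : W →ₗ[A] Z, ∃ h : W →ₗ[A] (Fin n → W), f.comp h = g := by
  let _ := Module.compHom Z (algebraMap R A)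
  have := tower_compHom R A Z
  let _ := Module.compHom W (algebraMap R A)
  have := tower_compHom R A W
  have := hom_finite R A W Z
  obtain ⟨n, F, hF⟩ := Module.Finite.exists_fin' R (W →ₗ[A] Z)
  refine ⟨n, LinearMap.lsum A (fun _ => W) ℕ (fun k => F (Pi.single k 1)), fun g => ?_⟩
  obtain ⟨c, rfl⟩ := hF g
  refine ⟨LinearMap.pi (fun k => c k • LinearMap.id), ?_⟩
  ext w
  have : F c = ∑ k, c k • F (Pi.single k 1) := by
    conv_lhs => rw [← LinearMap.sum_single_apply (fun _ => R) c]
    rw [map_sum]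
    refine Finset.sum_congr rfl fun k _ => ?_
    rw [← map_smul]
    congr 1
    ext l
    simp [Pi.single_apply]
  rw [this]
  simp only [LinearMap.comp_apply, LinearMap.lsum_apply, LinearMap.sum_apply,
    LinearMap.proj_apply, LinearMap.pi_apply, LinearMap.smul_apply, LinearMap.id_apply]
  refine Finset.sum_congr rfl fun k _ => ?_
  exact (F (Pi.single k 1)).map_smul (algebraMap R A (c k)) w


theorem facP_of_surj (A : Type) [Ring A] (T : Type) [AddCommGroup T] [Module A T] {M : Type} [AddCommGroup M]
    [Module A M] {ι : Type} [Finite ι] (f : (ι → T) →ₗ[A] M) (hf : Function.Surjective f) :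
    facP A T M := by
  obtain ⟨n, ⟨e⟩⟩ := Finite.exists_equiv_fin ι
  exact ⟨n, f.comp (LinearEquiv.funCongrLeft A T e).toLinearMap,
    hf.comp (LinearEquiv.funCongrLeft A T e).surjective⟩

theorem trace_pos (R A : Type) [CommRing R] [Ring A] [Algebra R A] [IsArtinianRing R]
    [Module.Finite R A] (T : Type) [AddCommGroup T] [Module A T] [Module.Finite A T] [IsArtinianRing A]
    {m : ℕ} (X : Fin m → ModuleCat.{0} A) (hX : ∀ j, isSummand A (X j) T)
    (c : Fin m → ℤ)
    (hc : ∀ (Z : Type) [AddCommGroup Z] [Module A Z] [Module.Finite A Z], facP A T Z →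
      ∑ j, c j * (hl R A (X j) Z : ℤ) = 0) (i : Fin m) (hi : 0 < c i)
    (B : AddSubgroup (X i)) (hB : ∀ j, c j < 0 → ∀ (f : X j →ₗ[A] X i) y, f y ∈ B) (x : X i) :
    x ∈ B := by
  classical
  choose s r hsr using hX
  have hr : ∀ j, Function.Surjective (r j) := fun j x => ⟨s j x, LinearMap.congr_fun (hsr j) x⟩
  have hXf : ∀ j, Module.Finite A (X j) := fun j => Module.Finite.of_surjective (r j) (hr j)
  let W : Type := (j : {j // c j < 0}) → X j
  obtain ⟨n, f, hf⟩ := exists_approx R A W (X i)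
  let I := LinearMap.range f
  have hfacI : facP A T I := by
    let u : (Fin n × {j // c j < 0} → T) →ₗ[A] (Fin n → W) :=
      LinearMap.pi fun k => LinearMap.pi fun j => (r j).comp (LinearMap.proj (k, j))
    have hu : Function.Surjective u := by
      intro w
      refine ⟨fun kj => s kj.2 (w kj.1 kj.2), ?_⟩
      ext k j
      exact LinearMap.congr_fun (hsr j) (w k j)
    exact facP_of_surj A T (f.rangeRestrict.comp u) (f.surjective_rangeRestrict.comp hu)
  have hfacX : facP A T (X i) :=
    ⟨1, (r i).comp (LinearMap.proj 0), (hr i).comp (fun t => ⟨fun _ => t, rfl⟩)⟩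
  have hle := fun j => hl_le R A (X j) I (X i) I.subtype I.injective_subtype
  have hneg : ∀ j, c j < 0 → hl R A (X j) I = hl R A (X j) (X i) := by
    intro j hj
    refine (hle j).2.2 fun g => ?_
    obtain ⟨h, hh⟩ := hf (g.comp (LinearMap.proj (⟨j, hj⟩ : {j // c j < 0})))
    refine ⟨g.codRestrict I fun y => ?_, rfl⟩
    refine ⟨h (Pi.single ⟨j, hj⟩ y), ?_⟩
    have := LinearMap.congr_fun hh (Pi.single ⟨j, hj⟩ y)
    have h2 : (Pi.single (⟨j, hj⟩ : {j // c j < 0}) y : (j : {j // c j < 0}) → X j) ⟨j, hj⟩ = y :=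
      Pi.single_eq_same _ _
    exact this.trans (congrArg g h2)
  have hsum : ∑ j, c j * ((hl R A (X j) (X i) : ℤ) - hl R A (X j) I) = 0 := by
    simp only [mul_sub, Finset.sum_sub_distrib]
    rw [hc _ hfacX, hc _ hfacI, sub_zero]
  have hz := (Finset.sum_eq_zero_iff_of_nonneg (by
    intro j _
    rcases lt_or_ge (c j) 0 with h | h
    · rw [hneg j h]; simp
    · have := (hle j).1
      exact mul_nonneg h (by omega))).1 hsum i (Finset.mem_univ _)
  have heq : hl R A (X i) I = hl R A (X i) (X i) := by
    rcases mul_eq_zero.1 hz with h | h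
    · omega
    · omega
  obtain ⟨g', hg'⟩ := (hle i).2.1 heq LinearMap.id
  have hx : x ∈ I := by
    have := LinearMap.congr_fun hg' x
    rw [LinearMap.id_apply] at this
    rw [← this]
    exact (g' x).2
  obtain ⟨w, rfl⟩ := hx
  rw [← LinearMap.sum_single_apply (fun _ => W) w, map_sum]
  refine AddSubgroup.sum_mem _ fun k _ => ?_
  have hw := LinearMap.sum_single_apply (fun j : {j // c j < 0} => X j) (w k)
  change (f.comp (LinearMap.single A (fun _ => W) k)) (w k) ∈ B
  rw [← hw, map_sum]
  refine AddSubgroup.sum_mem _ fun j _ => ?_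
  exact hB j j.2 ((f.comp (LinearMap.single A (fun _ => W) k)).comp
    (LinearMap.single A (fun j : {j // c j < 0} => X j) j)) (w k j)

theorem no_cycle (R A : Type) [CommRing R] [Ring A] [Algebra R A] [IsArtinianRing R]
    [Module.Finite R A] [IsArtinianRing A] {m : ℕ} (X : Fin m → ModuleCat.{0} A)
    (hXf : ∀ j, Module.Finite A (X j)) (hX : ∀ j, isIndec A (X j))
    (hne : ∀ j k, Nonempty (X j ≃ₗ[A] X k) → j = k) (s : Set (Fin m))
    (h : ∀ i ∈ s, ∀ B : AddSubgroup (X i),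
      (∀ j ∈ s, j ≠ i → ∀ (f : X j →ₗ[A] X i) y, f y ∈ B) → ∀ x, x ∈ B) (i : Fin m) :
    i ∉ s := by
  classical
  intro his
  let V : Type := (j : Fin m) → X j
  let _ := Module.compHom V (algebraMap R A)
  have := tower_compHom R A V
  have : Module.Finite R (Module.End A V) := hom_finite R A V V
  have : IsArtinianRing (Module.End A V) := IsArtinianRing.of_finite R _
  let J : Ideal (Module.End A V) := Ideal.jacobson ⊥
  obtain ⟨n, hn⟩ : IsNilpotent J := IsArtinianRing.isNilpotent_jacobson_bot
  have hJ : ∀ (j k : Fin m) (_ : j ≠ k) (f : X j →ₗ[A] X k),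
      (((LinearMap.single A (fun j => X j) k).comp f).comp (LinearMap.proj j) :
        Module.End A V) ∈ J := by
    intro j k hjk f
    refine Ideal.mem_jacobson_iff.2 fun y => ?_
    let a : X j →ₗ[A] V := LinearMap.comp y ((LinearMap.single A (fun j => X j) k).comp f)
    let b : V →ₗ[A] X j := LinearMap.proj j
    have hunit : IsUnit (1 + (b.comp a : Module.End A (X j))) := by
      rcases indec_end (hX j) (b.comp a : Module.End A (X j)) with h1 | h1
      · exfalso
        have := (hX j).1
        obtain ⟨e⟩ := indec_retract_iso (hX k) f
          (b.comp (LinearMap.comp y (LinearMap.single A (fun j => X j) k)))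
          ((Module.End.isUnit_iff _).1 h1)
        exact hjk (hne _ _ ⟨e⟩).symm
      · exact h1.isUnit_one_add
    obtain ⟨u, hu⟩ := hunit.exists_left_inv
    refine ⟨1 - (a.comp (LinearMap.comp u b) : Module.End A V), ?_⟩
    rw [Ideal.mem_bot]
    refine LinearMap.ext fun v => ?_
    have h1 := LinearMap.congr_fun hu (b v)
    have h2 : y (Pi.single k (f (v j))) = a (b v) := rfl
    simp only [Module.End.mul_apply, LinearMap.add_apply, Module.End.one_apply,
      LinearMap.comp_apply, map_add] at h1
    simp only [LinearMap.add_apply, LinearMap.sub_apply, Module.End.mul_apply,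
      Module.End.one_apply, LinearMap.comp_apply, LinearMap.zero_apply, LinearMap.proj_apply,
      LinearMap.coe_single, h2]
    have h3 : a (u (b v)) + a (u (b (a (b v)))) = a (b v) := by rw [← map_add, h1]
    change a (b v) - a (u (b (a (b v)))) + (v - a (u (b v))) - v = 0
    nth_rewrite 1 [← h3]
    abel
  let G : ℕ → AddSubgroup V := fun n =>
    AddSubgroup.closure {v | ∃ t ∈ J ^ n, ∃ w : V, v = t w}
  have hG : ∀ n, ∀ i ∈ s, ∀ x : X i, (Pi.single i x : V) ∈ G n := by
    intro n
    induction n with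
    | zero =>
      intro i _ x
      exact AddSubgroup.subset_closure ⟨1, by rw [Submodule.pow_zero, Ideal.one_eq_top]; trivial, _, rfl⟩
    | succ n ih =>
      intro i hi x
      refine h i hi ((G (n + 1)).comap (AddMonoidHom.single (fun j => X j) i)) ?_ x
      intro j hj hji f y
      let e : Module.End A V :=
        ((LinearMap.single A (fun j => X j) i).comp f).comp (LinearMap.proj j)
      have he : e ∈ J := hJ j i hji f
      have hle : G n ≤ (G (n + 1)).comap e.toAddMonoidHom := by
        refine (AddSubgroup.closure_le _).2 ?_
        rintro _ ⟨t, ht, w, rfl⟩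
        refine AddSubgroup.subset_closure ⟨e * t, ?_, w, rfl⟩
        rw [Ideal.IsTwoSided.pow_succ]
        exact Ideal.mul_mem_mul he ht
      have := hle (ih j hj y)
      change e (Pi.single j y) ∈ G (n + 1) at this
      have h2 : (Pi.single j y : (j : Fin m) → X j) j = y := Pi.single_eq_same _ _
      change (Pi.single i (f ((Pi.single j y : (j : Fin m) → X j) j)) : V) ∈ _ at this
      rwa [h2] at this
  have := (hX i).1
  obtain ⟨x, hx⟩ := exists_ne (0 : X i)
  have h0 : G n ≤ ⊥ := by
    refine (AddSubgroup.closure_le _).2 ?_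
    rintro _ ⟨t, ht, w, rfl⟩
    rw [hn] at ht
    have : t = 0 := ht
    simp [this]
  have := h0 (hG n i his x)
  rw [AddSubgroup.mem_bot] at this
  have h5 := congrFun this i
  exact hx ((Pi.single_eq_same (M := fun j => X j) i x).symm.trans h5)

theorem tilting_gen (R A : Type) [CommRing R] [Ring A] [Algebra R A] [IsArtinianRing R]
    [Module.Finite R A] (T : Type) [AddCommGroup T] [Module A T] [Module.Finite A T]
    {P₀ P₁ : Type} [AddCommGroup P₀] [Module A P₀] [AddCommGroup P₁]
    [Module A P₁] [Module.Projective A P₀] [Module.Projective A P₁]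
    (i : P₁ →ₗ[A] P₀) (p : P₀ →ₗ[A] T) (hi : Function.Injective i)
    (hp : Function.Surjective p) (hip : Function.Exact i p) (hT : EVan i T)
    (hnum : numIndec A T = numIndec A A) (Z : Type) [AddCommGroup Z] [Module A Z]
    [Module.Finite A Z] (hZ : EVan i Z) : facP A T Z := by
  classical
  have hAr : IsArtinianRing A := IsArtinianRing.of_finite R A
  have hfac : ∀ (Z : Type) [AddCommGroup Z] [Module A Z], facP A T Z → EVan i Z := by
    rintro Z _ _ ⟨n, f, hf⟩
    exact EVan_surj (EVan_pi hT _) f hf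
  -- indecomposable projectives
  obtain ⟨m, hm⟩ : ∃ m, numIndec A A = m := ⟨_, rfl⟩
  have hmT : numIndec A T = m := hnum.trans hm
  obtain ⟨Q, hQf, hQ⟩ : ∃ Q : Fin m → ModuleCat.{0} A, (∀ j, Module.Finite A (Q j)) ∧
      ∀ (X : Type) [AddCommGroup X] [Module A X], isIndec A X → isSummand A X A →
        ∃ j, Nonempty (X ≃ₗ[A] Q j) := by
    have := finite_classes (A := A) A
    subst hm
    let e := Finite.equivFin (Quotient (isoSetoid A (fun N => isIndec A ↥N ∧
      ∃ (s : ↥N →ₗ[A] A) (r : A →ₗ[A] ↥N), r.comp s = LinearMap.id)))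
    refine ⟨fun j => (e.symm j).out.1, fun j => ?_, ?_⟩
    · obtain ⟨s, r, h⟩ := (e.symm j).out.2.2
      exact Module.Finite.of_surjective r (fun x => ⟨s x, LinearMap.congr_fun h x⟩)
    · intro X _ _ hX hs
      let q : Quotient (isoSetoid A (fun N => isIndec A ↥N ∧
        ∃ (s : ↥N →ₗ[A] A) (r : A →ₗ[A] ↥N), r.comp s = LinearMap.id)) :=
        Quotient.mk _ ⟨ModuleCat.of A X, hX, hs⟩
      refine ⟨e q, ?_⟩
      have h1 : Nonempty (X ≃ₗ[A] q.out.1) := Quotient.exact (q.out_eq).symm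
      have h2 : e.symm (e q) = q := e.symm_apply_apply q
      rw [← h2] at h1
      exact h1
  obtain ⟨X, hXi, hXs, hXne⟩ : ∃ X : Fin m → ModuleCat.{0} A, (∀ j, isIndec A (X j)) ∧
      (∀ j, isSummand A (X j) T) ∧ ∀ j k, Nonempty (X j ≃ₗ[A] X k) → j = k := by
    have := finite_classes (A := A) T
    subst hmT
    let e := Finite.equivFin (Quotient (isoSetoid A (fun N => isIndec A ↥N ∧
      ∃ (s : ↥N →ₗ[A] T) (r : T →ₗ[A] ↥N), r.comp s = LinearMap.id)))
    refine ⟨fun j => (e.symm j).out.1, fun j => (e.symm j).out.2.1,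
      fun j => (e.symm j).out.2.2, fun j k h => ?_⟩
    apply e.symm.injective
    rw [← (e.symm j).out_eq, ← (e.symm k).out_eq]
    exact Quotient.sound h
  have hXf : ∀ j, Module.Finite A (X j) := fun j => by
    obtain ⟨s, r, h⟩ := hXs j
    exact Module.Finite.of_surjective r (fun x => ⟨s x, LinearMap.congr_fun h x⟩)
  -- the matrix
  have hg : ∀ k, ∃ g : Fin m → ℤ, ∀ (Z : Type) [AddCommGroup Z] [Module A Z] [Module.Finite A Z],
      EVan i Z → (hl R A (X k) Z : ℤ) = ∑ j, g j * (hl R A (Q j) Z : ℤ) := by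
    intro k
    obtain ⟨s, r, h⟩ := hXs k
    obtain ⟨n, f, hf⟩ := Module.Finite.exists_fin' A (X k)
    have hK : Module.Projective A (LinearMap.ker f) :=
      proj_of_compare hi hp hip (LinearMap.ker f).injective_subtype hf
        (LinearMap.exact_subtype_ker_map f) s r h
    obtain ⟨a, ha⟩ := hl_decomp R A Q hQf hQ _ (Fin n → A) rfl
    obtain ⟨b, hb⟩ := hl_decomp R A Q hQf hQ _ (LinearMap.ker f) rfl
    refine ⟨fun j => (a j : ℤ) - b j, ?_⟩
    intro Z _ _ _ hZ
    have := hl_exact R A (LinearMap.ker f) (Fin n → A) (X k) Z hf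
      (LinearMap.exact_subtype_ker_map f)
      (extend_of_compare hp hip (LinearMap.ker f).injective_subtype hf
        (LinearMap.exact_subtype_ker_map f) s r h (fun φ _ => hZ φ))
    rw [ha Z, hb Z] at this
    have this : (∑ j, (a j : ℤ) * (hl R A (Q j) Z : ℤ)) =
      hl R A (X k) Z + ∑ j, (b j : ℤ) * (hl R A (Q j) Z : ℤ) := by exact_mod_cast this
    simp only [sub_mul, Finset.sum_sub_distrib]
    linarith
  choose g hg using hg
  have hdet : (Matrix.of g).det ≠ 0 := by
    intro h0
    obtain ⟨c, hc0, hc⟩ := Matrix.exists_vecMul_eq_zero_iff.2 h0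
    have hrel : ∀ (Z : Type) [AddCommGroup Z] [Module A Z] [Module.Finite A Z], facP A T Z →
        ∑ j, c j * (hl R A (X j) Z : ℤ) = 0 := by
      intro Z _ _ _ hZ
      have e1 : ∀ j, (hl R A (X j) Z : ℤ) = _ := fun j => hg j Z (hfac Z hZ)
      simp only [e1, Finset.mul_sum]
      rw [Finset.sum_comm]
      refine Finset.sum_eq_zero fun k _ => ?_
      have := congrFun hc k
      simp only [Matrix.vecMul, dotProduct, Matrix.of_apply, Pi.zero_apply] at this
      simp only [← mul_assoc]
      rw [← Finset.sum_mul, this, zero_mul]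
    have hrel' : ∀ (Z : Type) [AddCommGroup Z] [Module A Z] [Module.Finite A Z], facP A T Z →
        ∑ j, (-c) j * (hl R A (X j) Z : ℤ) = 0 := by
      intro Z _ _ _ hZ
      simp [hrel Z hZ]
    obtain ⟨k, hk⟩ := Function.ne_iff.1 hc0
    refine no_cycle R A X hXf hXi hXne {j | c j ≠ 0} ?_ k hk
    intro l hl B hB x
    rcases lt_or_gt_of_ne (show c l ≠ 0 from hl) with h | h
    · refine trace_pos R A T X hXs (-c) hrel' l (by simpa using h) B ?_ x
      intro j hj
      have hj : 0 < c j := by simpa using hj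
      exact hB j hj.ne' (by rintro rfl; omega)
    · refine trace_pos R A T X hXs c hrel l h B ?_ x
      intro j hj
      exact hB j hj.ne (by rintro rfl; omega)
  -- the torsion-free part
  obtain ⟨n, f, hf⟩ := exists_approx R A T Z
  suffices hsurj : Function.Surjective f from ⟨n, f, hsurj⟩
  let I := LinearMap.range f
  have hIfac : facP A T I := ⟨n, f.rangeRestrict, f.surjective_rangeRestrict⟩
  have hFE : EVan i (Z ⧸ I) := EVan_surj hZ I.mkQ I.mkQ_surjective
  have hF0 : ∀ u : T →ₗ[A] Z ⧸ I, u = 0 := by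
    intro u
    obtain ⟨v, hv⟩ := lift_of_EVan hp hip (hfac I hIfac) I.injective_subtype
      (LinearMap.exact_subtype_mkQ I) I.mkQ_surjective u
    obtain ⟨w, hw⟩ := hf v
    ext t
    rw [← hv, ← hw]
    simp [I]
  have hX0 : ∀ k, hl R A (X k) (Z ⧸ I) = 0 := by
    intro k
    refine (hl_eq_zero R A _ _).2 ⟨fun u v => ?_⟩
    obtain ⟨s, r, h⟩ := hXs k
    have : ∀ u : X k →ₗ[A] Z ⧸ I, u = 0 := by
      intro u
      rw [← LinearMap.comp_id u, ← h, ← LinearMap.comp_assoc, hF0 (u.comp r), LinearMap.zero_comp]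
    rw [this u, this v]
  have hQ0 : ∀ j, hl R A (Q j) (Z ⧸ I) = 0 := by
    by_contra! hcon
    obtain ⟨j, hj⟩ := hcon
    refine hdet (Matrix.exists_mulVec_eq_zero_iff.1
      ⟨fun j => (hl R A (Q j) (Z ⧸ I) : ℤ), ?_, ?_⟩)
    · intro h
      have h6 : (hl R A (Q j) (Z ⧸ I) : ℤ) = 0 := congrFun h j
      exact hj (by exact_mod_cast h6)
    · ext k
      have := hg k (Z ⧸ I) hFE
      rw [hX0 k] at this
      simpa [Matrix.mulVec, dotProduct] using this.symm
  obtain ⟨a, ha⟩ := hl_decomp R A Q hQf hQ _ A rfl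
  have hA0 : hl R A A (Z ⧸ I) = 0 := by
    rw [ha]; simp [hQ0]
  have hsub := (hl_eq_zero R A A (Z ⧸ I)).1 hA0
  intro z
  have := LinearMap.congr_fun
    (hsub.elim (LinearMap.toSpanSingleton A (Z ⧸ I) (I.mkQ z)) 0) 1
  simp at this
  exact this
/-- Let `T` be a `1`-tilting module over an artin algebra `A`
(`pd_A(T) ≤ 1`, `Ext¹_A(T,T) = 0` and `|T| = |A|`).  Then for every `M ∈ fac(T)`, any
right `add(T)`-approximation `f : Tⁿ → M` is surjective with kernel in `fac(T)`;
consequently `fac(T)` has enough projective objects, and the projective objects of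
`fac(T)` are exactly the modules in `add(T)`. -/
theorem fac_enough_projectives_of_tilting
    (R A : Type) [CommRing R] [IsArtinianRing R] [Ring A] [Algebra R A] [Module.Finite R A]
    (T : Type) [AddCommGroup T] [Module A T] [Module.Finite A T]
    (hpd : pdLeOne A T) (hrigid : Subsingleton (egrp A 1 T T))
    (hnum : numIndec A T = numIndec A A) :
    (∀ (M : Type) [AddCommGroup M] [Module A M], facP A T M →
      ∀ (n : ℕ) (f : (Fin n → T) →ₗ[A] M),
        (∀ g : T →ₗ[A] M, ∃ h : T →ₗ[A] (Fin n → T), f.comp h = g) →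
        Function.Surjective f ∧ facP A T ↥(LinearMap.ker f)) ∧
    (∀ (M : Type) [AddCommGroup M] [Module A M], facP A T M →
      ∃ (n : ℕ) (f : (Fin n → T) →ₗ[A] M),
        Function.Surjective f ∧ facP A T ↥(LinearMap.ker f)) ∧
    (∀ (M : Type) [AddCommGroup M] [Module A M], facP A T M →
      (projInFac A T M ↔ addP A T M)) := by
  classical
  obtain ⟨P₀, P₁, h0, h1, i, p, hi, hp, hip⟩ := hpd
  have hT : EVan i T := bridge A T hrigid i p hi hp hip
  have hAr : IsArtinianRing A := IsArtinianRing.of_finite R A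
  have hfac : ∀ (Z : Type) [AddCommGroup Z] [Module A Z], facP A T Z → EVan i Z := by
    rintro Z _ _ ⟨n, f, hf⟩
    exact EVan_surj (EVan_pi hT _) f hf
  have part1 : ∀ (M : Type) [AddCommGroup M] [Module A M], facP A T M →
      ∀ (n : ℕ) (f : (Fin n → T) →ₗ[A] M),
        (∀ g : T →ₗ[A] M, ∃ h : T →ₗ[A] (Fin n → T), f.comp h = g) →
        Function.Surjective f ∧ facP A T ↥(LinearMap.ker f) := by
    rintro M _ _ ⟨k, g, hg⟩ n f hf
    refine ⟨?_, ?_⟩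
    · rw [← LinearMap.range_eq_top, eq_top_iff]
      rintro x -
      obtain ⟨w, rfl⟩ := hg x
      rw [← LinearMap.sum_single_apply (fun _ => T) w, map_sum]
      refine Submodule.sum_mem _ fun l _ => ?_
      obtain ⟨h, hh⟩ := hf (g.comp (LinearMap.single A (fun _ => T) l))
      exact ⟨h (w l), LinearMap.congr_fun hh (w l)⟩
    · have hE : EVan i (LinearMap.ker f) :=
        EVan_ker hp hip (EVan_pi hT (Fin n)) (LinearMap.ker f).injective_subtype
          (LinearMap.exact_subtype_ker_map f) hf
      exact tilting_gen R A T i p hi hp hip hT hnum _ hE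
  have part2 : ∀ (M : Type) [AddCommGroup M] [Module A M], facP A T M →
      ∃ (n : ℕ) (f : (Fin n → T) →ₗ[A] M),
        Function.Surjective f ∧ facP A T ↥(LinearMap.ker f) := by
    intro M _ _ hM
    have hMf : Module.Finite A M := by
      obtain ⟨k, g, hg⟩ := hM
      exact Module.Finite.of_surjective g hg
    obtain ⟨n, f, hf⟩ := exists_approx R A T M
    exact ⟨n, f, part1 M hM n f hf⟩
  refine ⟨part1, part2, ?_⟩
  intro M _ _ hM
  constructor
  · rintro ⟨-, hproj⟩
    obtain ⟨n, f, hf, hk⟩ := part2 M hM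
    obtain ⟨h, hh⟩ := hproj _ _ _ (LinearMap.ker f).subtype f
      (LinearMap.ker f).injective_subtype hf (LinearMap.exact_subtype_ker_map f) hk
      ⟨n, LinearMap.id, Function.surjective_id⟩ hM LinearMap.id
    exact ⟨n, h, f, hh⟩
  · rintro ⟨n, s, r, hsr⟩
    refine ⟨hM, ?_⟩
    intro X Y Z _ _ _ _ _ _ a b ha hb hab hX _ _ g
    choose u hu using fun l : Fin n => lift_of_EVan hp hip (hfac X hX) ha hab hb
      ((g.comp r).comp (LinearMap.single A (fun _ => T) l))
    refine ⟨(∑ l, (u l).comp (LinearMap.proj l)).comp s, ?_⟩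
    refine LinearMap.ext fun x => ?_
    have e1 : ∀ l, b (u l (s x l)) = g (r (Pi.single l (s x l))) :=
      fun l => LinearMap.congr_fun (hu l) (s x l)
    simp only [LinearMap.comp_apply, LinearMap.sum_apply, LinearMap.proj_apply, map_sum, e1]
    rw [← map_sum, ← map_sum]
    have e2 := LinearMap.sum_single_apply (fun _ => T) (s x)
    rw [e2]
    exact congrArg g (LinearMap.congr_fun hsr x)
end

section
/- Let T be a τ-rigid module over an artin algebra A with I = Ann(T) and Ā = A/I. Then T is τ-rigid as an A-module if and only if the corresponding Ā-module T is partial 1-tilting (pd_Ā(T) ≤ 1 and Ext¹_Ā(T,T) = 0) and I ⊗_A T = 0. -/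
open TensorProduct

section BalancedTensor

variable (R A : Type) [CommRing R] [Ring A] [Algebra R A]

/-- The relations defining the balanced tensor product over `A` inside `X ⊗[R] T`. -/
def balRel (X T : Type) [AddCommGroup X] [Module Aᵐᵒᵖ X] [Module R X]
    [AddCommGroup T] [Module A T] [Module R T] : Submodule R (X ⊗[R] T) :=
  Submodule.span R {z | ∃ (x : X) (a : A) (t : T),
    z = (MulOpposite.op a • x) ⊗ₜ[R] t - x ⊗ₜ[R] (a • t)}

/-- The balanced tensor product `X ⊗[A] T` of a right `A`-module `X` and a
left `A`-module `T`. -/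
def balTensor (X T : Type) [AddCommGroup X] [Module Aᵐᵒᵖ X] [Module R X]
    [AddCommGroup T] [Module A T] [Module R T] : Type :=
  (X ⊗[R] T) ⧸ balRel R A X T

noncomputable instance (X T : Type) [AddCommGroup X] [Module Aᵐᵒᵖ X] [Module R X]
    [AddCommGroup T] [Module A T] [Module R T] : AddCommGroup (balTensor R A X T) :=
  inferInstanceAs (AddCommGroup ((X ⊗[R] T) ⧸ balRel R A X T))

noncomputable instance (X T : Type) [AddCommGroup X] [Module Aᵐᵒᵖ X] [Module R X]
    [AddCommGroup T] [Module A T] [Module R T] : Module R (balTensor R A X T) :=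
  inferInstanceAs (Module R ((X ⊗[R] T) ⧸ balRel R A X T))

/-- Functoriality of the balanced tensor product in the second variable. -/
noncomputable def balMap (X : Type) [AddCommGroup X] [Module Aᵐᵒᵖ X] [Module R X]
    {T T' : Type} [AddCommGroup T] [Module A T] [Module R T] [IsScalarTower R A T]
    [AddCommGroup T'] [Module A T'] [Module R T'] [IsScalarTower R A T']
    (f : T →ₗ[A] T') : balTensor R A X T →ₗ[R] balTensor R A X T' :=
  Submodule.mapQ _ _ (TensorProduct.map LinearMap.id (f.restrictScalars R)) (by
    rw [← Submodule.map_le_iff_le_comap, balRel, Submodule.map_span]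
    apply Submodule.span_le.2
    rintro z ⟨w, ⟨x, a, t, rfl⟩, rfl⟩
    apply Submodule.subset_span
    exact ⟨x, a, f t, by simp [TensorProduct.map_tmul, map_smul]⟩)

/-- The kernel of the canonical free presentation `(T →₀ A) → T`. -/
noncomputable def presKer (T : Type) [AddCommGroup T] [Module A T] : Submodule A (T →₀ A) :=
  LinearMap.ker (Finsupp.linearCombination A (id : T → T))

/-- `Tor₁^A(X, T)`, computed from the canonical free presentation
`0 → K → (T →₀ A) → T → 0` of `T` as the kernel of `X ⊗[A] K → X ⊗[A] (T →₀ A)`. -/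
noncomputable def Tor1 (X T : Type) [AddCommGroup X] [Module Aᵐᵒᵖ X] [Module R X]
    [AddCommGroup T] [Module A T] [Module R T] [IsScalarTower R A T] : Type :=
  ↥(LinearMap.ker (balMap R A X (T := ↥(presKer A T)) (T' := (T →₀ A))
      ((presKer A T).subtype)))

noncomputable instance (X T : Type) [AddCommGroup X] [Module Aᵐᵒᵖ X] [Module R X]
    [AddCommGroup T] [Module A T] [Module R T] [IsScalarTower R A T] :
    AddCommGroup (Tor1 R A X T) :=
  inferInstanceAs (AddCommGroup ↥(LinearMap.ker (balMap R A X (T := ↥(presKer A T))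
    (T' := (T →₀ A)) ((presKer A T).subtype))))

noncomputable instance (X T : Type) [AddCommGroup X] [Module Aᵐᵒᵖ X] [Module R X]
    [AddCommGroup T] [Module A T] [Module R T] [IsScalarTower R A T] :
    Module R (Tor1 R A X T) :=
  inferInstanceAs (Module R ↥(LinearMap.ker (balMap R A X (T := ↥(presKer A T))
    (T' := (T →₀ A)) ((presKer A T).subtype))))

/-- A two-sided ideal regarded as a right submodule of `A`. -/
def rIdeal (I : TwoSidedIdeal A) : Submodule Aᵐᵒᵖ A where
  carrier := I
  add_mem' := I.add_mem
  zero_mem' := I.zero_mem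
  smul_mem' := fun a x hx => by simpa using I.mul_mem_right x a.unop hx

instance : IsScalarTower R Aᵐᵒᵖ A :=
  ⟨fun r a x => by
    show x * (r • a).unop = r • (x * a.unop)
    simp [mul_smul_comm]⟩

end BalancedTensor

/-- `T` is `τ`-rigid, via the Auslander–Smalø criterion `Ext¹_A(T, fac(T)) = 0`. -/
def tauRigid (A : Type) [Ring A] (T : Type) [AddCommGroup T] [Module A T] : Prop :=
  ∀ (M : Type) [AddCommGroup M] [Module A M], facP A T M → Subsingleton (egrp A 1 T M)

def ExtP {A : Type} [Ring A] {P T : Type} [AddCommGroup P] [Module A P]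
    [AddCommGroup T] [Module A T] (p : P →ₗ[A] T) (M : Type) [AddCommGroup M] [Module A M] : Prop :=
  ∀ f : LinearMap.ker p →ₗ[A] M, ∃ g : P →ₗ[A] M, ∀ k : LinearMap.ker p, g k = f k

lemma extP_indep {A : Type} [Ring A] {P P' T : Type} [AddCommGroup P] [Module A P]
    [AddCommGroup P'] [Module A P'] [Module.Projective A P] [Module.Projective A P']
    [AddCommGroup T] [Module A T] (p : P →ₗ[A] T) (p' : P' →ₗ[A] T)
    (hp : Function.Surjective p) (hp' : Function.Surjective p')
    (M : Type) [AddCommGroup M] [Module A M] (h : ExtP p M) : ExtP p' M := by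
  intro f
  obtain ⟨u, hu⟩ := Module.projective_lifting_property p' p hp'
  obtain ⟨v, hv⟩ := Module.projective_lifting_property p p' hp
  have hu' : ∀ x, p' (u x) = p x := fun x => LinearMap.congr_fun hu x
  have hv' : ∀ x, p (v x) = p' x := fun x => LinearMap.congr_fun hv x
  let uk : LinearMap.ker p →ₗ[A] LinearMap.ker p' :=
    (u.comp (LinearMap.ker p).subtype).codRestrict _ (fun x => by
      have := x.2
      simp only [LinearMap.mem_ker] at this
      simp [hu', this])
  let w : P' →ₗ[A] LinearMap.ker p' :=
    (u.comp v - LinearMap.id).codRestrict _ (fun x => by simp [hu', hv'])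
  obtain ⟨g, hg⟩ := h (f.comp uk)
  refine ⟨g.comp v - f.comp w, fun k => ?_⟩
  have hk : v k ∈ LinearMap.ker p := by
    have := k.2
    simp only [LinearMap.mem_ker] at this
    simp [hv', this]
  have h1 := hg ⟨v k, hk⟩
  simp only [LinearMap.comp_apply] at h1
  simp only [LinearMap.sub_apply, LinearMap.comp_apply, h1, ← map_sub]
  congr 1
  ext
  show u (v k) - (u (v k) - (k : P')) = k
  abel

lemma proj_ker {A : Type} [Ring A] {P P' T : Type} [AddCommGroup P] [Module A P]
    [AddCommGroup P'] [Module A P'] [Module.Projective A P] [Module.Projective A P']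
    [AddCommGroup T] [Module A T] (p : P →ₗ[A] T) (p' : P' →ₗ[A] T)
    (hp : Function.Surjective p) (hp' : Function.Surjective p')
    [Module.Projective A (LinearMap.ker p)] : Module.Projective A (LinearMap.ker p') := by
  apply Module.Projective.of_lifting_property''
  intro q hq
  obtain ⟨u, hu⟩ := Module.projective_lifting_property p' p hp'
  obtain ⟨v, hv⟩ := Module.projective_lifting_property p p' hp
  have hu' : ∀ x, p' (u x) = p x := fun x => LinearMap.congr_fun hu x
  have hv' : ∀ x, p (v x) = p' x := fun x => LinearMap.congr_fun hv x
  let uk : LinearMap.ker p →ₗ[A] LinearMap.ker p' :=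
    (u.comp (LinearMap.ker p).subtype).codRestrict _ (fun x => by
      have := x.2
      simp only [LinearMap.mem_ker] at this
      simp [hu', this])
  let vk : LinearMap.ker p' →ₗ[A] LinearMap.ker p :=
    (v.comp (LinearMap.ker p').subtype).codRestrict _ (fun x => by
      have := x.2
      simp only [LinearMap.mem_ker] at this
      simp [hv', this])
  let w : P' →ₗ[A] LinearMap.ker p' :=
    (u.comp v - LinearMap.id).codRestrict _ (fun x => by simp [hu', hv'])
  obtain ⟨h, hh⟩ := Module.projective_lifting_property q uk hq
  obtain ⟨w', hw⟩ := Module.projective_lifting_property q w hq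
  refine ⟨h.comp vk - w'.comp (LinearMap.ker p').subtype, ?_⟩
  ext k
  have e1 : q (h (vk k)) = uk (vk k) := LinearMap.congr_fun hh _
  have e2 : q (w' k) = w k := LinearMap.congr_fun hw _
  show ((q (h (vk k) - w' k) : LinearMap.ker p') : P') = k
  rw [map_sub, e1, e2]
  show u (v k) - (u (v k) - (k : P')) = k
  abel

open CategoryTheory in
lemma egrp_iff_some {A : Type} [Ring A] (T : Type) [AddCommGroup T] [Module A T] :
    ∃ (P : ModuleCat.{0} A) (_ : Module.Projective A P) (p : P →ₗ[A] T),
      Function.Surjective p ∧ ∀ (M : Type) [AddCommGroup M] [Module A M],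
        Subsingleton (egrp A 1 T M) ↔ ExtP p M := by
  let Q := ProjectiveResolution.of (ModuleCat.of A T)
  let p : Q.complex.X 0 ⟶ ModuleCat.of A T := Q.π.f 0 
  have hsurj : Function.Surjective p := (ModuleCat.epi_iff_surjective _).1 (inferInstanceAs (Epi (Q.π.f 0)))
  have hd : ∀ x, p (Q.complex.d 1 0 x) = 0 := fun x => 
    LinearMap.congr_fun (congrArg ModuleCat.Hom.hom Q.complex_d_comp_π_f_zero) x
  have hex0 : ∀ y, p y = 0 → ∃ x, Q.complex.d 1 0 x = y :=
    (ShortComplex.moduleCat_exact_iff _).1 Q.exact₀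
  have hex1 : ∀ y, Q.complex.d 1 0 y = 0 → ∃ x, Q.complex.d 2 1 x = y :=
    (ShortComplex.moduleCat_exact_iff _).1 (Q.exact_succ 0)
  have hdd : ∀ x, Q.complex.d 1 0 (Q.complex.d 2 1 x) = 0 := fun x => 
    LinearMap.congr_fun (congrArg ModuleCat.Hom.hom (Q.complex.d_comp_d 2 1 0)) x
  refine ⟨Q.complex.X 0, ?_, p.hom, hsurj, ?_⟩
  · exact (IsProjective.iff_projective _).2 (Q.projective 0)
  intro M _ _
  have e1 : Subsingleton (egrp A 1 T M) ↔
      ∀ f : Q.complex.X 1 ⟶ ModuleCat.of A M, Q.complex.d 2 1 ≫ f = 0 → 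
        ∃ g : Q.complex.X 0 ⟶ ModuleCat.of A M, Q.complex.d 1 0 ≫ g = f := by
    have i := Q.isoExt (R := ℤ) 1 (ModuleCat.of A M)
    have : Subsingleton (egrp A 1 T M) ↔ Limits.IsZero ((Q.complex.linearYonedaObj ℤ (ModuleCat.of A M)).homology 1) := by
      rw [← i.isZero_iff, ModuleCat.isZero_iff_subsingleton]
      rfl
    rw [this, ← HomologicalComplex.exactAt_iff_isZero_homology, 
      HomologicalComplex.exactAt_iff' _ 0 1 2 (by simp) (by simp), ShortComplex.moduleCat_exact_iff]
    rfl
  rw [e1]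
  constructor
  · intro h f
    let d' : Q.complex.X 1 →ₗ[A] LinearMap.ker p.hom := (Q.complex.d 1 0).hom.codRestrict _ hd
    obtain ⟨g, hg⟩ := h (ModuleCat.ofHom (f.comp d')) (by
      ext x
      have : d' (Q.complex.d 2 1 x) = 0 := Subtype.ext (hdd x)
      show f (d' (Q.complex.d 2 1 x)) = 0
      rw [this, map_zero])
    refine ⟨g.hom, ?_⟩
    rintro ⟨k, hk⟩
    obtain ⟨x, rfl⟩ := hex0 k hk
    exact LinearMap.congr_fun (congrArg ModuleCat.Hom.hom hg) x
  · intro h f hf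
    have hf' : ∀ x, f (Q.complex.d 2 1 x) = 0 := fun x => 
      LinearMap.congr_fun (congrArg ModuleCat.Hom.hom hf) x
    let d' : Q.complex.X 1 →ₗ[A] LinearMap.ker p.hom := (Q.complex.d 1 0).hom.codRestrict _ hd
    have hd' : Function.Surjective d' := by
      rintro ⟨k, hk⟩
      obtain ⟨x, rfl⟩ := hex0 k hk
      exact ⟨x, rfl⟩
    have hle : LinearMap.ker d' ≤ LinearMap.ker f.hom := by
      intro x hx
      have : Q.complex.d 1 0 x = 0 := congrArg Subtype.val (LinearMap.mem_ker.1 hx)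
      obtain ⟨y, rfl⟩ := hex1 x this
      exact hf' y
    let f' : LinearMap.ker p.hom →ₗ[A] M :=
      ((LinearMap.ker d').liftQ f.hom hle).comp (d'.quotKerEquivOfSurjective hd').symm.toLinearMap
    obtain ⟨g, hg⟩ := h f'
    refine ⟨ModuleCat.ofHom g, ?_⟩
    ext x
    have h2 := hg (d' x)
    have h3 : (d'.quotKerEquivOfSurjective hd').symm (d' x) = Submodule.Quotient.mk x := by
      rw [LinearEquiv.symm_apply_eq]; rfl
    have h4 : f' (d' x) = f x := by
      show ((LinearMap.ker d').liftQ f.hom hle) ((d'.quotKerEquivOfSurjective hd').symm (d' x)) = _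
      rw [h3]; rfl
    exact h2.trans h4

lemma egrp_iff {A : Type} [Ring A] {T P : Type} [AddCommGroup T] [Module A T] 
    [AddCommGroup P] [Module A P] [Module.Projective A P] (p : P →ₗ[A] T)
    (hp : Function.Surjective p) (M : Type) [AddCommGroup M] [Module A M] :
    Subsingleton (egrp A 1 T M) ↔ ExtP p M := by
  obtain ⟨P', _, p', hp', h⟩ := egrp_iff_some (A := A) T
  rw [h M]
  exact ⟨extP_indep p' p hp' hp M, extP_indep p p' hp hp' M⟩

lemma pd_iff {B : Type} [Ring B] {T P : Type} [AddCommGroup T] [Module B T] 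
    [AddCommGroup P] [Module B P] [Module.Projective B P] (p : P →ₗ[B] T)
    (hp : Function.Surjective p) : pdLeOne B T ↔ Module.Projective B (LinearMap.ker p) := by
  constructor
  · rintro ⟨P₀, P₁, _, _, i, q, hi, hq, hex⟩
    have e : LinearMap.ker q = LinearMap.range i := by
      ext x; exact hex x
    have : Module.Projective B (LinearMap.ker q) := by
      rw [e]
      exact Module.Projective.of_equiv (LinearEquiv.ofInjective i hi)
    exact proj_ker q p hq hp
  · intro h
    refine ⟨ModuleCat.of B P, ModuleCat.of B (LinearMap.ker p), ‹_›, h, (LinearMap.ker p).subtype,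
      p, Subtype.val_injective, hp, ?_⟩
    intro x
    simp

def IKs {A : Type} [Ring A] (I : TwoSidedIdeal A) {P : Type} [AddCommGroup P] [Module A P]
    (K : Submodule A P) : Submodule A P :=
  Submodule.span A {y | ∃ i ∈ I, ∃ k ∈ K, y = i • k}

lemma bal_lift_lin {S A : Type} [CommRing S] [Ring A] [Algebra S A] {X T G : Type}
    [AddCommGroup X] [Module Aᵐᵒᵖ X] [Module S X]
    [AddCommGroup T] [Module A T] [Module S T] [AddCommGroup G] [Module S G]
    (b : X →ₗ[S] T →ₗ[S] G)
    (hb : ∀ (x : X) (a : A) (t : T), b (MulOpposite.op a • x) t = b x (a • t))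
    (h : Subsingleton (balTensor S A X T)) (x : X) (t : T) : b x t = 0 := by
  let F : X ⊗[S] T →ₗ[S] G := TensorProduct.lift b
  have hF : ∀ i t, F (i ⊗ₜ t) = b i t := fun i t => rfl
  have hle : balRel S A X T ≤ LinearMap.ker F := by
    apply Submodule.span_le.2
    rintro z ⟨i, a, t, rfl⟩
    refine LinearMap.mem_ker.2 ?_
    rw [map_sub, hF, hF, sub_eq_zero, hb]
  have htop : ∀ z, z ∈ balRel S A X T := by
    intro z
    have : (Submodule.Quotient.mk z : (X ⊗[S] T) ⧸ balRel S A X T) = 0 :=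
      h.elim _ _
    exact (Submodule.Quotient.mk_eq_zero _).1 this
  exact LinearMap.mem_ker.1 (hle (htop (x ⊗ₜ t)))

lemma bal_lift {A : Type} [Ring A] {X T G : Type} [AddCommGroup X] [Module Aᵐᵒᵖ X]
    [mX : Module ℤ X]
    [AddCommGroup T] [Module A T] [mT : Module ℤ T] [AddCommGroup G] (b : X →+ T →+ G)
    (hb : ∀ (x : X) (a : A) (t : T), b (MulOpposite.op a • x) t = b x (a • t))
    (h : Subsingleton (balTensor ℤ A X T)) (x : X) (t : T) : b x t = 0 := by
  obtain rfl : mX = AddCommGroup.toIntModule X := Subsingleton.elim _ _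
  obtain rfl : mT = AddCommGroup.toIntModule T := Subsingleton.elim _ _
  exact bal_lift_lin (S := ℤ) (A := A) (LinearMap.mk₂ ℤ (fun x t => b x t) (by simp) (by simp)
    (by simp) (by simp)) hb h x t

lemma tensor_fwd {A : Type} [Ring A] (I : TwoSidedIdeal A) {P T : Type} [AddCommGroup P]
    [Module A P] [AddCommGroup T] [Module A T] (p : P →ₗ[A] T) (hp : Function.Surjective p)
    (h : Subsingleton (balTensor ℤ A (↥(rIdeal A I)) T)) (i : A) (hi : i ∈ I) (x : P) :
    i • x ∈ IKs I (LinearMap.ker p) := by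
  let s : T → P := Function.surjInv hp
  have hs : ∀ t, p (s t) = t := Function.surjInv_eq hp
  let J := IKs I (LinearMap.ker p)
  have key : ∀ (i : rIdeal A I) (x y : P), p x = p y →
      (Submodule.Quotient.mk ((i : A) • x) : P ⧸ J) = Submodule.Quotient.mk ((i : A) • y) := by
    intro i x y hxy
    rw [Submodule.Quotient.eq, ← smul_sub]
    exact Submodule.subset_span ⟨i, i.2, x - y, by simp [hxy], rfl⟩
  let b : rIdeal A I →+ T →+ (P ⧸ J) := AddMonoidHom.mk' (fun i =>
    AddMonoidHom.mk' (fun t => Submodule.Quotient.mk ((i : A) • s t)) (fun t t' => by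
      rw [← Submodule.Quotient.mk_add, ← smul_add]
      exact key i _ _ (by simp [hs]))) (fun i j => by
      ext t
      simp [add_smul])
  have hb : ∀ (i : rIdeal A I) (a : A) (t : T), b (MulOpposite.op a • i) t = b i (a • t) := by
    intro i a t
    show (Submodule.Quotient.mk (((MulOpposite.op a • i : rIdeal A I) : A) • s t) : P ⧸ J) =
      Submodule.Quotient.mk ((i : A) • s (a • t))
    have : ((MulOpposite.op a • i : rIdeal A I) : A) • s t = (i : A) • (a • s t) := by
      rw [smul_smul]; rfl
    rw [this]
    exact key i _ _ (by simp [hs])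
  have h1 := bal_lift (A := A) b hb h ⟨i, hi⟩ (p x)
  have h2 : b ⟨i, hi⟩ (p x) = Submodule.Quotient.mk (i • s (p x)) := rfl
  rw [h2, key ⟨i, hi⟩ _ x (hs _)] at h1
  exact (Submodule.Quotient.mk_eq_zero _).1 h1

lemma tensor_bwd {A : Type} [Ring A] (I : TwoSidedIdeal A) {n : ℕ} {T : Type}
    [AddCommGroup T] [Module A T] (p : (Fin n → A) →ₗ[A] T) (hp : Function.Surjective p)
    (h : ∀ i ∈ I, ∀ x : Fin n → A, i • x ∈ IKs I (LinearMap.ker p)) :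
    Subsingleton (balTensor ℤ A (↥(rIdeal A I)) T) := by
  let e : Fin n → T := fun j => p (Pi.single j 1)
  have he : ∀ x, p x = ∑ j, x j • e j := by
    intro x
    conv_lhs => rw [pi_eq_sum_univ' x]
    rw [map_sum]
    refine Finset.sum_congr rfl fun j _ => ?_
    rw [map_smul]
  let Bq := (rIdeal A I ⊗[ℤ] T) ⧸ balRel ℤ A (↥(rIdeal A I)) T
  let mk : rIdeal A I → T → Bq := fun i t => Submodule.Quotient.mk (i ⊗ₜ t)
  have mk_bal : ∀ (i : rIdeal A I) (a : A) (t : T) (h : (i : A) * a ∈ rIdeal A I),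
      mk ⟨(i : A) * a, h⟩ t = mk i (a • t) := by
    intro i a t h
    exact (Submodule.Quotient.eq _).2 (Submodule.subset_span ⟨i, a, t, rfl⟩)
  have mk_add : ∀ (i j : rIdeal A I) t, mk (i + j) t = mk i t + mk j t := by
    intro i j t
    simp only [mk, TensorProduct.add_tmul]; rfl
  have mk_sum : ∀ (i : rIdeal A I) (f : Fin n → T), mk i (∑ j, f j) = ∑ j, mk i (f j) := by
    intro i f
    simp only [mk, TensorProduct.tmul_sum]
    exact map_sum (Submodule.mkQ (balRel ℤ A (↥(rIdeal A I)) T)) _ _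
  have mk_zero : ∀ t, mk 0 t = 0 := by
    intro t
    simp only [mk, TensorProduct.zero_tmul]; rfl
  have mk_zero' : ∀ i, mk i 0 = 0 := by
    intro t
    simp only [mk, TensorProduct.tmul_zero]; rfl
  have key : ∀ x ∈ IKs I (LinearMap.ker p), ∀ a : A, ∃ hx : ∀ j, a * x j ∈ rIdeal A I,
      ∑ j, mk ⟨a * x j, hx j⟩ (e j) = 0 := by
    intro x hx
    induction hx using Submodule.span_induction with
    | mem x hx =>
      obtain ⟨i, hi, k, hk, rfl⟩ := hx
      intro a
      have hai : a * i ∈ rIdeal A I := I.mul_mem_left _ _ hi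
      have hx : ∀ j, a * (i • k) j ∈ rIdeal A I := fun j => by
        simp only [Pi.smul_apply, smul_eq_mul, ← mul_assoc]
        exact I.mul_mem_right _ _ hai
      refine ⟨hx, ?_⟩
      have : ∀ j, mk ⟨a * (i • k) j, hx j⟩ (e j) = mk ⟨a * i, hai⟩ (k j • e j) := by
        intro j
        rw [← mk_bal ⟨a * i, hai⟩ (k j) (e j) (I.mul_mem_right _ _ hai)]
        congr 2
        simp [mul_assoc]
      simp only [this]
      rw [← mk_sum, ← he, LinearMap.mem_ker.1 hk, mk_zero']
    | zero =>
      intro a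
      have h0 : ∀ j : Fin n, a * (0 : Fin n → A) j = 0 := by simp
      refine ⟨fun j => by rw [h0]; exact Submodule.zero_mem _, ?_⟩
      refine Finset.sum_eq_zero fun j _ => ?_
      rw [← mk_zero (e j)]
      congr 1
      ext
      simp
    | add x y _ _ hx hy =>
      intro a
      obtain ⟨h1, h2⟩ := hx a
      obtain ⟨h3, h4⟩ := hy a
      have h5 : ∀ j, a * (x + y) j ∈ rIdeal A I := fun j => by
        simp only [Pi.add_apply, mul_add]
        exact Submodule.add_mem _ (h1 j) (h3 j)
      refine ⟨h5, ?_⟩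
      have : ∀ j, mk ⟨a * (x + y) j, h5 j⟩ (e j) =
          mk ⟨a * x j, h1 j⟩ (e j) + mk ⟨a * y j, h3 j⟩ (e j) := by
        intro j
        rw [← mk_add]
        congr 1
        ext
        simp [mul_add]
      simp only [this]
      rw [Finset.sum_add_distrib, h2, h4, add_zero]
    | smul b x _ hx =>
      intro a
      obtain ⟨h1, h2⟩ := hx (a * b)
      have h3 : ∀ j, a * (b • x) j = a * b * x j := by simp [mul_assoc]
      refine ⟨fun j => by rw [h3]; exact h1 j, ?_⟩
      rw [← h2]
      refine Finset.sum_congr rfl fun j _ => ?_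
      congr 2
      exact h3 j
  have hz : ∀ i t, mk i t = 0 := by
    intro i t
    obtain ⟨x, rfl⟩ := hp t
    rw [he, mk_sum]
    obtain ⟨h1, h2⟩ := key _ (h i i.2 x) 1
    rw [← h2]
    refine Finset.sum_congr rfl fun j _ => ?_
    rw [← mk_bal _ _ _ (I.mul_mem_right _ _ i.2)]
    congr 2
    simp
  have hall : ∀ z : Bq, z = 0 := by
    intro z
    obtain ⟨z, rfl⟩ := Submodule.Quotient.mk_surjective _ z
    induction z using TensorProduct.induction_on with
    | zero => rfl
    | tmul i t => exact hz i t
    | add x y hx hy => rw [Submodule.Quotient.mk_add, hx, hy, add_zero]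
  exact ⟨fun a b => (hall a).trans (hall b).symm⟩

lemma fac_cover {B : Type} [Ring B] {T Z : Type} [AddCommGroup T] [Module B T]
    [AddCommGroup Z] [Module B Z]
    (hgen : ∀ z : Z, ∃ (m : ℕ) (h : (Fin m → T) →ₗ[B] Z), z ∈ LinearMap.range h)
    (N : Submodule B Z) (hN : N.FG) :
    ∃ (m : ℕ) (h : (Fin m → T) →ₗ[B] Z), N ≤ LinearMap.range h := by
  induction N, hN using Submodule.fg_induction with
  | singleton z =>
    obtain ⟨m, h, hz⟩ := hgen z
    exact ⟨m, h, by rwa [Submodule.span_singleton_le_iff_mem]⟩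
  | sup N₁ N₂ _ _ h₁ h₂ =>
    obtain ⟨m, f, hf⟩ := h₁
    obtain ⟨l, g, hg⟩ := h₂
    let e : (Fin (m + l) → T) ≃ₗ[B] (Fin m → T) × (Fin l → T) :=
      (LinearEquiv.funCongrLeft B T finSumFinEquiv).trans
        (LinearEquiv.sumArrowLequivProdArrow (Fin m) (Fin l) B T)
    refine ⟨m + l, (f.coprod g).comp e.toLinearMap, ?_⟩
    rw [LinearMap.range_comp_of_range_eq_top _ (LinearEquiv.range e), LinearMap.range_coprod]
    exact sup_le_sup hf hg

lemma inj_gen {B : Type} [Ring B] {T E : Type} [AddCommGroup T] [Module B T]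
    [AddCommGroup E] [Module B E] [Module.Injective B E] {m : ℕ}
    (ι : B →ₗ[B] (Fin m → T)) (hι : Function.Injective ι) (z : E) :
    ∃ (m : ℕ) (h : (Fin m → T) →ₗ[B] E), z ∈ LinearMap.range h := by
  obtain ⟨h, hh⟩ := Module.Injective.out ι hι (LinearMap.toSpanSingleton B E z)
  exact ⟨m, h, ι 1, by rw [hh]; simp⟩

open CategoryTheory in
lemma enough_inj {B : Type} [Ring B] (Y : Type) [AddCommGroup Y] [Module B Y] :
    ∃ (E : ModuleCat.{0} B) (_ : Module.Injective B E) (j : Y →ₗ[B] E), Function.Injective j := by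
  obtain ⟨E, hE, f, hf⟩ := EnoughInjectives.presentation (ModuleCat.of B Y)
  refine ⟨E, ?_, f.hom, (ModuleCat.mono_iff_injective f).1 hf⟩
  exact Module.injective_module_of_injective_object B E

lemma proj_of_fac {B : Type} [Ring B] {T P : Type} [AddCommGroup T] [Module B T]
    [AddCommGroup P] [Module B P] [Module.Projective B P] (p : P →ₗ[B] T) {m : ℕ}
    (ι : B →ₗ[B] (Fin m → T)) (hι : Function.Injective ι)
    (hfg : (LinearMap.ker p).FG)
    (h : ∀ (M : Type) [AddCommGroup M] [Module B M], facP B T M → ExtP p M) :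
    Module.Projective B (LinearMap.ker p) := by
  apply Module.Projective.of_lifting_property''
  intro q hq
  obtain ⟨E, _, j, hj⟩ := enough_inj (B := B) (LinearMap.ker p →₀ B)
  let X : Submodule B E := (LinearMap.ker q).map j
  let g₀ : ((LinearMap.ker p →₀ B) ⧸ LinearMap.ker q) →ₗ[B] (E ⧸ X) :=
    Submodule.mapQ _ _ j (Submodule.le_comap_map _ _)
  let g : LinearMap.ker p →ₗ[B] (E ⧸ X) :=
    g₀.comp (q.quotKerEquivOfSurjective hq).symm.toLinearMap
  have hg : ∀ y, g (q y) = Submodule.Quotient.mk (j y) := by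
    intro y
    have h3 : (q.quotKerEquivOfSurjective hq).symm (q y) = Submodule.Quotient.mk y := by
      rw [LinearEquiv.symm_apply_eq]; rfl
    show g₀ ((q.quotKerEquivOfSurjective hq).symm (q y)) = _
    rw [h3]; rfl
  have hgen : ∀ z : E ⧸ X, ∃ (m : ℕ) (h : (Fin m → T) →ₗ[B] (E ⧸ X)), z ∈ LinearMap.range h := by
    intro z
    obtain ⟨z, rfl⟩ := Submodule.Quotient.mk_surjective _ z
    obtain ⟨m, f, x, rfl⟩ := inj_gen ι hι z
    exact ⟨m, X.mkQ.comp f, x, rfl⟩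
  have : Module.Finite B (LinearMap.ker p) := Module.Finite.iff_fg.2 hfg
  obtain ⟨l, c, hc⟩ := fac_cover hgen (LinearMap.range g) (Module.Finite.iff_fg.1 (Module.Finite.range g))
  obtain ⟨G, hG⟩ := h (LinearMap.range c) ⟨l, c.rangeRestrict, c.surjective_rangeRestrict⟩
    (g.codRestrict _ (fun k => hc ⟨k, rfl⟩))
  obtain ⟨H, hH⟩ := Module.projective_lifting_property X.mkQ ((LinearMap.range c).subtype.comp G)
    (Submodule.mkQ_surjective _)
  have key : ∀ k : LinearMap.ker p, ∃ y, j y = H k ∧ q y = k := by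
    intro k
    obtain ⟨y, rfl⟩ := hq k
    have h1 : (Submodule.Quotient.mk (H (q y)) : E ⧸ X) = G (q y) := LinearMap.congr_fun hH _
    rw [hG, LinearMap.codRestrict_apply, hg, Submodule.Quotient.eq] at h1
    obtain ⟨y', hy', hy2⟩ := h1
    refine ⟨y' + y, by rw [map_add, hy2]; abel, ?_⟩
    have : q y' = 0 := hy'
    rw [map_add, this, zero_add]
  let s : LinearMap.ker p →ₗ[B] (LinearMap.ker p →₀ B) :=
    (LinearEquiv.ofInjective j hj).symm.toLinearMap.comp
      ((H.comp (LinearMap.ker p).subtype).codRestrict (LinearMap.range j) (fun k => by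
        obtain ⟨y, h1, _⟩ := key k
        exact ⟨y, h1⟩))
  refine ⟨s, ?_⟩
  ext1 k
  obtain ⟨y, h1, h2⟩ := key k
  have : s k = y := by
    apply hj
    rw [h1]
    have := LinearEquiv.ofInjective_apply j (h := hj) (s k)
    rw [← this]
    simp [s]
  show q (s k) = k
  rw [this, h2]

lemma lc_single {A : Type} [Ring A] {n : ℕ} {T : Type} [AddCommGroup T] [Module A T]
    (p : (Fin n → A) →ₗ[A] T) (x : Fin n → A) : p x = ∑ j, x j • p (Pi.single j 1) := by
  conv_lhs => rw [pi_eq_sum_univ' x]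
  rw [map_sum]
  refine Finset.sum_congr rfl fun j _ => ?_
  rw [map_smul]

/-- extension along the quotient of a map out of a free module -/
noncomputable def desc {A B : Type} [Ring A] [Ring B] {n : ℕ} {T : Type}
    [AddCommGroup T] [Module A T] [Module B T]
    (p : (Fin n → A) →ₗ[A] T) : (Fin n → B) →ₗ[B] T :=
  Fintype.linearCombination B (fun j => p (Pi.single j 1))

lemma desc_apply {A B : Type} [Ring A] [Ring B] (φ : A →+* B) {n : ℕ} {T : Type}
    [AddCommGroup T] [Module A T] [Module B T] (hc : ∀ (a : A) (t : T), φ a • t = a • t)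
    (p : (Fin n → A) →ₗ[A] T) (x : Fin n → A) :
    desc (B := B) p (fun j => φ (x j)) = p x := by
  rw [lc_single p x, desc, Fintype.linearCombination_apply]
  simp only [hc]

lemma rigid_B {A B : Type} [Ring A] [Ring B] (φ : A →+* B) (hsurj : Function.Surjective φ)
    {n : ℕ} {T : Type}
    [AddCommGroup T] [Module A T] [Module B T] (hc : ∀ (a : A) (t : T), φ a • t = a • t)
    (p : (Fin n → A) →ₗ[A] T)
    (h : ∀ (M : Type) [AddCommGroup M] [Module A M], facP A T M → ExtP p M)
    (M : Type) [AddCommGroup M] [Module B M] (hM : facP B T M) :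
    ExtP (desc (B := B) p) M := by
  intro f
  letI : Module A M := Module.compHom M φ
  have hcM : ∀ (a : A) (t : M), φ a • t = a • t := fun a t => rfl
  have hfac : facP A T M := by
    obtain ⟨m, c, hcs⟩ := hM
    refine ⟨m, { toFun := c, map_add' := map_add c, map_smul' := fun a x => ?_ }, hcs⟩
    have : a • x = φ a • x := by
      ext j; exact (hc a (x j)).symm
    rw [this, map_smul]; rfl
  let f' : LinearMap.ker p →ₗ[A] M :=
    { toFun := fun k => f ⟨fun j => φ (k.1 j), by
        rw [LinearMap.mem_ker, desc_apply φ hc]; exact k.2⟩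
      map_add' := fun k l => by
        rw [← map_add]
        congr 1
        ext j
        simp
      map_smul' := fun a k => by
        rw [RingHom.id_apply, ← hcM, ← map_smul]
        congr 1
        ext j
        simp }
  obtain ⟨g, hg⟩ := h M hfac f'
  refine ⟨desc g, ?_⟩
  rintro ⟨kb, hk⟩
  obtain ⟨k, rfl⟩ : ∃ k : Fin n → A, (fun j => φ (k j)) = kb :=
    ⟨fun j => Function.surjInv hsurj (kb j), by ext j; exact Function.surjInv_eq hsurj _⟩
  have hk' : k ∈ LinearMap.ker p := by
    rw [LinearMap.mem_ker, desc_apply φ hc] at hk; exact hk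
  show desc g (fun j => φ (k j)) = _
  rw [desc_apply φ hcM]
  exact hg ⟨k, hk'⟩

/-- the module structure over the quotient on a module killed by the kernel -/
lemma exists_modB {A B : Type} [Ring A] [Ring B] (φ : A →+* B) (hsurj : Function.Surjective φ)
    (M : Type) [AddCommGroup M] [Module A M] (h : ∀ a, φ a = 0 → ∀ m : M, a • m = 0) :
    ∃ _ : Module B M, ∀ (a : A) (m : M), φ a • m = a • m := by
  letI : SMul B M := ⟨fun b m => Function.surjInv hsurj b • m⟩
  have hs : ∀ (a : A) (m : M), φ a • m = a • m := by
    intro a m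
    show Function.surjInv hsurj (φ a) • m = a • m
    rw [← sub_eq_zero, ← sub_smul]
    exact h _ (by rw [map_sub, Function.surjInv_eq hsurj, sub_self]) m
  exact ⟨hsurj.moduleLeft φ hs, hs⟩

lemma exists_embed (R A : Type) [CommRing R] [Ring A] [Algebra R A]
    [Module.Finite R A]
    (T : Type) [AddCommGroup T] [Module A T] [Module.Finite A T]
    (B : Type) [Ring B] (φ : A →+* B) (hsurj : Function.Surjective φ)
    (hker : ∀ a : A, φ a = 0 ↔ ∀ t : T, a • t = 0)
    [Module B T] (hcomp : ∀ (a : A) (t : T), φ a • t = a • t) :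
    ∃ (m : ℕ) (ι : B →ₗ[B] (Fin m → T)), Function.Injective ι := by
  letI : Module R T := Module.compHom T (algebraMap R A)
  have hR : ∀ (r : R) (t : T), r • t = algebraMap R A r • t := fun _ _ => rfl
  haveI : IsScalarTower R A T := ⟨fun r a t => by rw [hR, Algebra.smul_def, mul_smul]⟩
  haveI : Module.Finite R T := Module.Finite.trans A T
  obtain ⟨m, s, hs⟩ := Module.Finite.exists_fin (R := R) (M := T)
  refine ⟨m, LinearMap.pi (fun j => LinearMap.toSpanSingleton B T (s j)), ?_⟩
  rw [← LinearMap.ker_eq_bot, LinearMap.ker_eq_bot']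
  intro b hb
  obtain ⟨a, rfl⟩ := hsurj b
  rw [hker]
  intro t
  have ht : t ∈ Submodule.span R (Set.range s) := by rw [hs]; trivial
  induction ht using Submodule.span_induction with
  | mem x hx =>
    obtain ⟨j, rfl⟩ := hx
    rw [← hcomp]
    exact congrFun hb j
  | zero => simp
  | add x y _ _ hx hy => rw [smul_add, hx, hy, add_zero]
  | smul r x _ hx => rw [hR, smul_smul, ← Algebra.commutes, mul_smul, hx, smul_zero]

lemma tau_tensor {A B : Type} [Ring A] [Ring B] (φ : A →+* B) (hsurj : Function.Surjective φ)
    (I : TwoSidedIdeal A) (hker : ∀ a : A, φ a = 0 ↔ a ∈ I)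
    {P T : Type} [AddCommGroup P] [Module A P] 
    [AddCommGroup T] [Module A T] [Module B T] (hI : ∀ a ∈ I, ∀ t : T, a • t = 0) 
    (hc : ∀ (a : A) (t : T), φ a • t = a • t)
    (p : P →ₗ[A] T) (hfg : (LinearMap.ker p).FG) {m : ℕ}
    (ι : B →ₗ[B] (Fin m → T)) (hι : Function.Injective ι)
    (h : ∀ (M : Type) [AddCommGroup M] [Module A M], facP A T M → ExtP p M)
    (i : A) (hi : i ∈ I) (x : P) : i • x ∈ IKs I (LinearMap.ker p) := by
  let K := LinearMap.ker p
  let J : Submodule A K := (IKs I K).comap K.subtype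
  obtain ⟨_, hQ⟩ := exists_modB φ hsurj (K ⧸ J) (by
    intro a ha z
    obtain ⟨k, rfl⟩ := Submodule.Quotient.mk_surjective _ z
    rw [← Submodule.Quotient.mk_smul, Submodule.Quotient.mk_eq_zero]
    exact Submodule.subset_span ⟨a, (hker a).1 ha, k, k.2, rfl⟩)
  obtain ⟨E, _, j, hj⟩ := enough_inj (B := B) (K ⧸ J)
  letI : Module A E := Module.compHom E φ
  have hE : ∀ (a : A) (t : E), φ a • t = a • t := fun a t => rfl
  let g : K →ₗ[A] E :=
    { toFun := fun k => j (Submodule.Quotient.mk k)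
      map_add' := fun k l => by rw [Submodule.Quotient.mk_add, map_add]
      map_smul' := fun a k => by
        rw [Submodule.Quotient.mk_smul, ← hQ, map_smul]; rfl }
  have : Module.Finite A K := Module.Finite.iff_fg.2 hfg
  have hfin : (LinearMap.range g).FG := Module.Finite.iff_fg.1 (Module.Finite.range g)
  obtain ⟨s, hs⟩ := hfin
  obtain ⟨l, c, hcov⟩ := fac_cover (inj_gen (E := E) ι hι) (Submodule.span B (s : Set E)) ⟨s, rfl⟩
  let c' : (Fin l → T) →ₗ[A] E :=
    { toFun := c
      map_add' := map_add c
      map_smul' := fun a x => by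
        have : a • x = φ a • x := by
          ext j; exact (hc a (x j)).symm
        rw [this, map_smul]; rfl }
  have hrange : ∀ k, g k ∈ LinearMap.range c' := by
    intro k
    have h1 : LinearMap.range g ≤ LinearMap.range c' := by
      rw [← hs]
      apply Submodule.span_le.2
      intro y hy
      obtain ⟨w, hw⟩ := hcov (Submodule.subset_span hy)
      exact ⟨w, hw⟩
    exact h1 ⟨k, rfl⟩
  obtain ⟨G, hG⟩ := h (LinearMap.range c') ⟨l, c'.rangeRestrict, c'.surjective_rangeRestrict⟩
    (g.codRestrict _ hrange)
  have hix : i • x ∈ K := by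
    show p (i • x) = 0
    rw [map_smul, hI i hi]
  have h1 := hG ⟨i • x, hix⟩
  have h2 : G (i • x) = 0 := by
    rw [map_smul]
    apply Subtype.ext
    show i • ((G x : LinearMap.range c') : E) = 0
    rw [← hE, (hker i).2 hi, zero_smul]
  have h3 : g ⟨i • x, hix⟩ = 0 := congrArg Subtype.val (h1.symm.trans h2)
  have h4 : (Submodule.Quotient.mk (⟨i • x, hix⟩ : K) : K ⧸ J) = 0 := by
    apply hj
    rw [map_zero]; exact h3
  exact (Submodule.Quotient.mk_eq_zero J).1 h4

lemma back {A B : Type} [Ring A] [Ring B] (φ : A →+* B) (hsurj : Function.Surjective φ)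
    (I : TwoSidedIdeal A) (hker : ∀ a : A, φ a = 0 ↔ a ∈ I) {n : ℕ}
    {T : Type}
    [AddCommGroup T] [Module A T] [Module B T] (hI : ∀ a ∈ I, ∀ t : T, a • t = 0) 
    (hc : ∀ (a : A) (t : T), φ a • t = a • t)
    (p : (Fin n → A) →ₗ[A] T)
    [Module.Projective B (LinearMap.ker (desc (B := B) p))]
    (hT : ExtP (desc (B := B) p) T)
    (hIK : ∀ i ∈ I, ∀ x, i • x ∈ IKs I (LinearMap.ker p))
    (M : Type) [AddCommGroup M] [Module A M] (hM : facP A T M) : ExtP p M := by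
  intro f
  obtain ⟨m, c, hcs⟩ := hM
  have hIM : ∀ a ∈ I, ∀ z : M, a • z = 0 := by
    intro a ha z
    obtain ⟨y, rfl⟩ := hcs z
    rw [← map_smul]
    have : a • y = 0 := by ext j; exact hI a ha _
    rw [this, map_zero]
  obtain ⟨_, hcM⟩ := exists_modB φ hsurj M (fun a ha => hIM a ((hker a).1 ha))
  have hf0' : ∀ x ∈ IKs I (LinearMap.ker p), ∃ hx : x ∈ LinearMap.ker p, f ⟨x, hx⟩ = 0 := by
    intro x hx
    have hle : IKs I (LinearMap.ker p) ≤ (LinearMap.ker f).map (LinearMap.ker p).subtype := by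
      apply Submodule.span_le.2
      rintro y ⟨i, hi, k, hk, rfl⟩
      refine ⟨i • ⟨k, hk⟩, ?_, rfl⟩
      show f (i • _) = 0
      rw [map_smul, hIM i hi]
    obtain ⟨k, hk, rfl⟩ := hle hx
    exact ⟨k.2, hk⟩
  have hf0 : ∀ k : LinearMap.ker p, (∀ j, φ (k.1 j) = 0) → f k = 0 := by
    intro k hk
    have : k.1 ∈ IKs I (LinearMap.ker p) := by
      rw [pi_eq_sum_univ' k.1]
      exact Submodule.sum_mem _ fun j _ => hIK _ ((hker _).1 (hk j)) _
    exact (hf0' _ this).2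
  let σ : B → A := Function.surjInv hsurj
  have hσ : ∀ b, φ (σ b) = b := Function.surjInv_eq hsurj
  have hσk : ∀ kb : LinearMap.ker (desc (B := B) p), (fun j => σ (kb.1 j)) ∈ LinearMap.ker p := by
    intro kb
    have := kb.2
    rw [LinearMap.mem_ker] at this ⊢
    rw [← desc_apply φ hc]
    simpa only [hσ] using this
  have huniq : ∀ k l : LinearMap.ker p, (∀ j, φ (k.1 j) = φ (l.1 j)) → f k = f l := by
    intro k l hkl
    rw [← sub_eq_zero, ← map_sub]
    apply hf0
    intro j
    simp [hkl]
  let fb : LinearMap.ker (desc (B := B) p) →ₗ[B] M :=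
    { toFun := fun kb => f ⟨_, hσk kb⟩
      map_add' := fun k l => by
        rw [← map_add]
        apply huniq
        intro j
        simp [hσ]
      map_smul' := fun b k => by
        obtain ⟨a, rfl⟩ := hsurj b
        rw [RingHom.id_apply, hcM, ← map_smul]
        apply huniq
        intro j
        simp [hσ] }
  let cb : (Fin m → T) →ₗ[B] M :=
    { toFun := c
      map_add' := map_add c
      map_smul' := fun b x => by
        obtain ⟨a, rfl⟩ := hsurj b
        have : φ a • x = a • x := by
          ext j; exact (hc a (x j))
        rw [this, map_smul, RingHom.id_apply, hcM] }
  obtain ⟨l, hl⟩ := Module.projective_lifting_property cb fb hcs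
  choose g hg using fun j => hT ((LinearMap.proj j).comp l)
  let G : (Fin n → B) →ₗ[B] M := cb.comp (LinearMap.pi g)
  refine ⟨{ toFun := fun x => G (fun j => φ (x j)), map_add' := ?_, map_smul' := ?_ }, ?_⟩
  · intro x y
    rw [← map_add]; congr 1; ext j; simp
  · intro a x
    rw [RingHom.id_apply, ← hcM, ← map_smul]; congr 1; ext j; simp
  · intro k
    have hk : (fun j => φ (k.1 j)) ∈ LinearMap.ker (desc (B := B) p) := by
      rw [LinearMap.mem_ker, desc_apply φ hc]; exact k.2
    show cb (LinearMap.pi g (fun j => φ (k.1 j))) = f k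
    have h1 : LinearMap.pi g (fun j => φ (k.1 j)) = l ⟨_, hk⟩ := by
      ext j
      exact hg j ⟨_, hk⟩
    rw [h1]
    have h2 : cb (l ⟨_, hk⟩) = fb ⟨_, hk⟩ := LinearMap.congr_fun hl _
    rw [h2]
    apply huniq
    intro j
    simp [hσ]

/-- Let `T` be a finitely generated module over an artin algebra `A`,
`I = Ann(T)` and `Ā = A/I` (presented by a surjective ring homomorphism `φ : A → B` with
kernel `I`).  Then `T` is `τ`-rigid over `A` if and only if `T` is a partial `1`-tilting
`Ā`-module (`pd_Ā(T) ≤ 1` and `Ext¹_Ā(T,T) = 0`) with `I ⊗[A] T = 0`. -/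
theorem tauRigid_iff_partial_tilting_over_quotient
    (R A : Type) [CommRing R] [IsArtinianRing R] [Ring A] [Algebra R A] [Module.Finite R A]
    (T : Type) [AddCommGroup T] [Module A T] [Module.Finite A T]
    (I : TwoSidedIdeal A) (hI : ∀ a : A, a ∈ I ↔ ∀ t : T, a • t = 0)
    (B : Type) [Ring B] (φ : A →+* B) (hsurj : Function.Surjective φ)
    (hker : ∀ a : A, φ a = 0 ↔ a ∈ I)
    [Module B T] (hcomp : ∀ (a : A) (t : T), φ a • t = a • t) :
    tauRigid A T ↔
      (pdLeOne B T ∧ Subsingleton (egrp B 1 T T) ∧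
        Subsingleton (balTensor ℤ A (↥(rIdeal A I)) T)) := by
  have hI' : ∀ a ∈ I, ∀ t : T, a • t = 0 := fun a ha => (hI a).1 ha
  haveI : IsNoetherian R A := isNoetherian_of_isNoetherianRing_of_finite R A
  haveI : IsNoetherianRing A := isNoetherian_of_tower R inferInstance
  haveI : IsNoetherianRing B := isNoetherianRing_of_surjective A B φ hsurj
  obtain ⟨n, p, hp⟩ := Module.Finite.exists_fin' A T
  have hpb : Function.Surjective (desc (B := B) p) := by
    intro t
    obtain ⟨x, rfl⟩ := hp t
    exact ⟨_, desc_apply φ hcomp p x⟩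
  obtain ⟨m, ι, hι⟩ := exists_embed R A T B φ hsurj (fun a => (hker a).trans (hI a)) hcomp
  rw [pd_iff (desc (B := B) p) hpb, egrp_iff (desc (B := B) p) hpb]
  constructor
  · intro h
    have hA : ∀ (M : Type) [AddCommGroup M] [Module A M], facP A T M → ExtP p M :=
      fun M _ _ hM => (egrp_iff p hp M).1 (h M hM)
    have hB := fun (M : Type) [AddCommGroup M] [Module B M] => rigid_B φ hsurj hcomp p hA M
    refine ⟨proj_of_fac _ ι hι (IsNoetherian.noetherian _) hB, hB T ?_, ?_⟩
    · exact ⟨1, LinearMap.proj 0, fun t => ⟨fun _ => t, rfl⟩⟩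
    · exact tensor_bwd I p hp (tau_tensor φ hsurj I hker hI' hcomp p (IsNoetherian.noetherian _)
        ι hι hA)
  · rintro ⟨h1, h2, h3⟩ M _ _ hM
    rw [egrp_iff p hp]
    exact back φ hsurj I hker hI' hcomp p h2 (tensor_fwd I p hp h3) M hM
end
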